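/- arXiv:2404.08475 — 3 statements merged into one kernel-verified Lean document; each statement's English description precedes it below -/
import Mathlib

section
/- Suppose ρ : 𝒳 × 𝒴 → ℝ is given by ρ(X, W) = ∫₀^∞ G_W(1 − F_{X|W=·}(x)) dx + ∫_{−∞}^0 (G_W(1 − F_{X|W=·}(x)) − 1) dx with a law-invariant family of monotone functionals {G_W : W ∈ 𝒴}. Then ρ is a coherent factor risk measure if and only if {G_W} satisfies Condition A: for all f₁, f₂, g₁, g₂ ∈ D* with g₁ ≤ f₁, f₂ ≤ g₂ and f₁ + f₂ = g₁ + g₂, one has G_W(f₁) + G_W(f₂) ≥ G_W(g₁) + G_W(g₂) for all W ∈ 𝒴. -/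
open MeasureTheory ProbabilityTheory Set Filter

noncomputable section

/-- The probability measure `P` is atomless. -/
def Atomless {Ω : Type*} [MeasurableSpace Ω] (P : Measure Ω) : Prop :=
  ∀ A : Set Ω, MeasurableSet A → 0 < P A →
    ∃ B, B ⊆ A ∧ MeasurableSet B ∧ 0 < P B ∧ P B < P A

/-- A bounded (measurable) random variable, i.e. a member of `𝒳 = L^∞`. -/
def BddRV {Ω : Type*} [MeasurableSpace Ω] (X : Ω → ℝ) : Prop :=
  Measurable X ∧ ∃ C : ℝ, ∀ ω, |X ω| ≤ C

/-- Two random variables are comonotonic. -/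
def Comonotonic {Ω : Type*} (X₁ X₂ : Ω → ℝ) : Prop :=
  ∃ (Z : Ω → ℝ) (f₁ f₂ : ℝ → ℝ), Monotone f₁ ∧ Monotone f₂ ∧
    (∀ x, f₁ x + f₂ x = x) ∧ (∀ ω, X₁ ω = f₁ (Z ω)) ∧ (∀ ω, X₂ ω = f₂ (Z ω))

/-- `K` is a Markov-kernel version of the conditional distribution of `X` given `W`. -/
def IsCondDistrib {Ω : Type*} [MeasurableSpace Ω] {N : ℕ} (P : Measure Ω)
    (X : Ω → ℝ) (W : Ω → (Fin N → ℝ)) (K : Kernel (Fin N → ℝ) ℝ) : Prop :=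
  IsMarkovKernel K ∧
    ∀ B : Set ℝ, MeasurableSet B → ∀ S : Set (Fin N → ℝ), MeasurableSet S →
      P ({ω | X ω ∈ B} ∩ W ⁻¹' S) = ∫⁻ w in S, K w B ∂(P.map W)

/-- Membership in `D*`: Borel measurable functions `ℝ^N → [0,1]`. -/
def InDstar {N : ℕ} (f : (Fin N → ℝ) → ℝ) : Prop :=
  Measurable f ∧ ∀ w, f w ∈ Icc (0:ℝ) 1

/-- A monotone distortion functional on `D*` (monotone w.r.t. the `μ`-a.e. order). -/
def MonotoneFunctional {N : ℕ} (μ : Measure (Fin N → ℝ))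
    (G : ((Fin N → ℝ) → ℝ) → ℝ) : Prop :=
  (∀ f, InDstar f → G f ∈ Icc (0:ℝ) 1) ∧
  G (fun _ => 0) = 0 ∧ G (fun _ => 1) = 1 ∧
  ∀ f g, InDstar f → InDstar g → (∀ᵐ w ∂μ, g w ≤ f w) → G g ≤ G f

/-- The distortion factor risk measure value. -/
def distortionRM {N : ℕ} (G : ((Fin N → ℝ) → ℝ) → ℝ) (K : Kernel (Fin N → ℝ) ℝ) : ℝ :=
  (∫ x in Ioi (0:ℝ), G (fun w => 1 - (K w (Iic x)).toReal)) +
  (∫ x in Iio (0:ℝ), ((G (fun w => 1 - (K w (Iic x)).toReal)) - 1))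

def chq {Ω : Type*} (ν : Set Ω → ℝ) (X : Ω → ℝ) : ℝ :=
  (∫ x in Ioi (0:ℝ), ν {ω | x < X ω}) + (∫ x in Iio (0:ℝ), (ν {ω | x < X ω} - 1))

structure Capac {Ω : Type*} [MeasurableSpace Ω] (ν : Set Ω → ℝ) : Prop where
  mono : ∀ A B, MeasurableSet A → MeasurableSet B → A ⊆ B → ν A ≤ ν B
  empty : ν ∅ = 0
  univ : ν univ = 1

lemma Capac.antitone {Ω : Type*} [MeasurableSpace Ω] {ν : Set Ω → ℝ} (h : Capac ν)
    {X : Ω → ℝ} (hX : Measurable X) : Antitone (fun x => ν {ω | x < X ω}) := by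
  intro x y hxy
  exact h.mono _ _ (measurableSet_lt measurable_const hX) (measurableSet_lt measurable_const hX)
    (fun ω hω => lt_of_le_of_lt hxy hω)

lemma chq_eq {Ω : Type*} [MeasurableSpace Ω] {ν : Set Ω → ℝ} (h : Capac ν)
    {X : Ω → ℝ} (hX : Measurable X) {a b : ℝ} (ha : a ≤ 0) (hb : 0 ≤ b)
    (hXa : ∀ ω, a ≤ X ω) (hXb : ∀ ω, X ω ≤ b) :
    chq ν X = (∫ x in a..b, ν {ω | x < X ω}) + a := by
  have hanti := h.antitone hX
  have hint : ∀ c d : ℝ, IntervalIntegrable (fun x => ν {ω | x < X ω}) volume c d :=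
    fun c d => hanti.intervalIntegrable
  have h1 : (∫ x in Ioi (0:ℝ), ν {ω | x < X ω}) = ∫ x in (0:ℝ)..b, ν {ω | x < X ω} := by
    rw [intervalIntegral.integral_of_le hb]
    apply setIntegral_eq_of_subset_of_forall_sdiff_eq_zero measurableSet_Ioi Ioc_subset_Ioi_self
    intro x hx
    have : {ω | x < X ω} = ∅ := by
      ext ω
      simp only [mem_ofPred_eq, mem_empty_iff_false, iff_false, not_lt]
      have := hx.2
      simp only [mem_Ioc, not_and, not_le] at this
      exact (hXb ω).trans (this hx.1).le
    rw [this, h.empty]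
  have h2 : (∫ x in Iio (0:ℝ), (ν {ω | x < X ω} - 1)) = ∫ x in a..0, (ν {ω | x < X ω} - 1) := by
    rw [intervalIntegral.integral_of_le ha, ← integral_Ico_eq_integral_Ioc]
    apply setIntegral_eq_of_subset_of_forall_sdiff_eq_zero measurableSet_Iio Ico_subset_Iio_self
    intro x hx
    have : {ω | x < X ω} = Set.univ := by
      ext ω
      simp only [mem_ofPred_eq, mem_univ, iff_true]
      have := hx.2
      simp only [mem_Ico, not_and, not_lt] at this
      by_contra hcon
      push Not at hcon
      have h3 := this ((hXa ω).trans hcon)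
      have h4 := hx.1
      simp only [mem_Iio] at h4
      linarith
    rw [this, h.univ, sub_self]
  rw [chq, h1, h2, intervalIntegral.integral_sub (hint _ _) (by simp),
    ← intervalIntegral.integral_add_adjacent_intervals (hint a 0) (hint 0 b)]
  simp
  ring

lemma chq_add_const {Ω : Type*} [MeasurableSpace Ω] {ν : Set Ω → ℝ} (h : Capac ν)
    {X : Ω → ℝ} (hX : BddRV X) (c : ℝ) : chq ν (fun ω => X ω + c) = chq ν X + c := by
  obtain ⟨hm, C, hC⟩ := hX
  have hC' : ∀ ω, -|C| ≤ X ω ∧ X ω ≤ |C| := fun ω =>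
    abs_le.1 ((hC ω).trans (le_abs_self C))
  have h1 := neg_abs_le c
  have h2 := le_abs_self c
  have h3 := abs_nonneg C
  have h4 := abs_nonneg c
  rw [chq_eq h hm (a := -(|C| + |c|)) (b := |C| + |c|) (by linarith) (by linarith)
      (fun ω => by linarith [(hC' ω).1]) (fun ω => by linarith [(hC' ω).2]),
    chq_eq h (hm.add_const c) (a := -(|C| + |c|) + c) (b := |C| + |c| + c) (by linarith) (by linarith)
      (fun ω => by linarith [(hC' ω).1]) (fun ω => by linarith [(hC' ω).2])]
  have := intervalIntegral.integral_comp_sub_right (a := -(|C| + |c|) + c) (b := |C| + |c| + c)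
    (fun x => ν {ω | x < X ω}) c
  simp only [add_sub_cancel_right] at this
  rw [← this]
  simp only [sub_lt_iff_lt_add]
  ring

lemma chq_mul {Ω : Type*} [MeasurableSpace Ω] {ν : Set Ω → ℝ} (h : Capac ν)
    {X : Ω → ℝ} (hX : BddRV X) (l : ℝ) (hl : 0 ≤ l) :
    chq ν (fun ω => l * X ω) = l * chq ν X := by
  obtain ⟨hm, C, hC⟩ := hX
  have hC' : ∀ ω, -|C| ≤ X ω ∧ X ω ≤ |C| := fun ω =>
    abs_le.1 ((hC ω).trans (le_abs_self C))
  have h3 := abs_nonneg C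
  rcases hl.eq_or_lt with rfl | hl
  · rw [chq_eq h (a := 0) (b := 0) (hm.const_mul 0) le_rfl le_rfl (by simp) (by simp)]
    simp
  · rw [chq_eq h hm (a := -|C|) (b := |C|) (by linarith) (by linarith)
      (fun ω => by linarith [(hC' ω).1]) (fun ω => by linarith [(hC' ω).2]),
    chq_eq h (hm.const_mul l) (a := l * -|C|) (b := l * |C|) (by nlinarith) (by positivity)
      (fun ω => mul_le_mul_of_nonneg_left (hC' ω).1 hl.le)
      (fun ω => mul_le_mul_of_nonneg_left (hC' ω).2 hl.le)]
    have := intervalIntegral.integral_comp_div (a := l * -|C|) (b := l * |C|)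
      (fun x => ν {ω | x < X ω}) hl.ne'
    rw [mul_div_cancel_left₀ _ hl.ne', mul_div_cancel_left₀ _ hl.ne'] at this
    simp only [div_lt_iff₀' hl] at this
    rw [this]
    simp
    ring

lemma count_step {Ω : Type*} [MeasurableSpace Ω] {ν : Set Ω → ℝ} (h : Capac ν)
    (hsub : ∀ A B, MeasurableSet A → MeasurableSet B → ν (A ∩ B) + ν (A ∪ B) ≤ ν A + ν B)
    (Z : Ω → ℕ) (hZ : Measurable Z) (A : Set Ω) (hA : MeasurableSet A) (M : ℕ) :
    ∑ k ∈ Finset.range M, ν {ω | k < Z ω + A.indicator (fun _ => 1) ω} ≤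
      ∑ k ∈ Finset.range M, ν {ω | k < Z ω} + ν A := by
  have hB : ∀ k, MeasurableSet {ω | k ≤ Z ω} := fun k => measurableSet_le measurable_const hZ
  have key : ∑ k ∈ Finset.range M, ν {ω | k < Z ω + A.indicator (fun _ => 1) ω} ≤
      ∑ k ∈ Finset.range M, ν {ω | k < Z ω} + (ν ({ω | 0 ≤ Z ω} ∩ A) - ν ({ω | M ≤ Z ω} ∩ A)) := by
    induction M with
    | zero => simp
    | succ M ih =>
      rw [Finset.sum_range_succ, Finset.sum_range_succ]
      have := hsub {ω | M + 1 ≤ Z ω} ({ω | M ≤ Z ω} ∩ A) (hB _) ((hB _).inter hA)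
      have e1 : {ω | M + 1 ≤ Z ω} ∩ ({ω | M ≤ Z ω} ∩ A) = {ω | M + 1 ≤ Z ω} ∩ A := by
        ext ω; simp; omega
      have e2 : {ω | M + 1 ≤ Z ω} ∪ ({ω | M ≤ Z ω} ∩ A) =
          {ω | M < Z ω + A.indicator (fun _ => 1) ω} := by
        ext ω
        by_cases hω : ω ∈ A <;> simp [hω] <;> omega
      have e3 : {ω | M + 1 ≤ Z ω} = {ω | M < Z ω} := rfl
      rw [e1, e2] at this
      rw [← e3]
      linarith
  have e4 : {ω | 0 ≤ Z ω} ∩ A = A := by ext; simp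
  have e5 := h.mono ∅ ({ω | M ≤ Z ω} ∩ A) MeasurableSet.empty ((hB _).inter hA) (by simp)
  rw [e4] at key
  rw [h.empty] at e5
  linarith

lemma count_sum {Ω : Type*} [MeasurableSpace Ω] {ν : Set Ω → ℝ} (h : Capac ν)
    (hsub : ∀ A B, MeasurableSet A → MeasurableSet B → ν (A ∩ B) + ν (A ∪ B) ≤ ν A + ν B)
    (Z : Ω → ℕ) (hZ : Measurable Z) (A : ℕ → Set Ω) (hA : ∀ j, MeasurableSet (A j)) (M m : ℕ) :
    ∑ k ∈ Finset.range M,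
      ν {ω | k < Z ω + ∑ j ∈ Finset.range m, (A j).indicator (fun _ => 1) ω} ≤
      ∑ k ∈ Finset.range M, ν {ω | k < Z ω} + ∑ j ∈ Finset.range m, ν (A j) := by
  induction m with
  | zero => simp
  | succ m ih =>
    have := count_step h hsub (fun ω => Z ω + ∑ j ∈ Finset.range m, (A j).indicator (fun _ => 1) ω)
      (hZ.add (Finset.measurable_sum _ fun j _ => measurable_const.indicator (hA j))) (A m) (hA m) M
    simp only [Finset.sum_range_succ _ m, ← add_assoc]
    linarith

lemma le_count {m : ℕ} {x : ℝ} (hx : x ≤ m) :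
    x ≤ ((∑ j ∈ Finset.range m, if (j:ℝ) < x then 1 else 0 : ℕ) : ℝ) := by
  induction m with
  | zero => simpa using hx
  | succ m ih =>
    rw [Finset.sum_range_succ]
    by_cases hm : (m:ℝ) < x
    · have : ∑ j ∈ Finset.range m, (if (j:ℝ) < x then 1 else 0 : ℕ) = m := by
        rw [Finset.sum_congr rfl (g := fun _ => 1)]
        · simp
        · intro j hj
          have : (j:ℝ) < m := by exact_mod_cast Finset.mem_range.1 hj
          rw [if_pos (this.trans hm)]
      rw [this, if_pos hm]
      exact_mod_cast hx
    · rw [if_neg hm, add_zero]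
      exact ih (not_lt.1 hm)

lemma chq_sub_aux {Ω : Type*} [MeasurableSpace Ω] {ν : Set Ω → ℝ} (h : Capac ν)
    (hsub : ∀ A B, MeasurableSet A → MeasurableSet B → ν (A ∩ B) + ν (A ∪ B) ≤ ν A + ν B)
    {X Y : Ω → ℝ} (hX : Measurable X) (hY : Measurable Y) (m : ℕ)
    (hX0 : ∀ ω, 0 ≤ X ω) (hXm : ∀ ω, X ω ≤ m) (hY0 : ∀ ω, 0 ≤ Y ω) (hYm : ∀ ω, Y ω ≤ m) :
    chq ν (fun ω => X ω + Y ω) ≤ chq ν X + chq ν Y + 2 := by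
  have hXs : ∀ j : ℕ, MeasurableSet {ω | (j:ℝ) < X ω} := fun j =>
    measurableSet_lt measurable_const hX
  have hYs : ∀ j : ℕ, MeasurableSet {ω | (j:ℝ) < Y ω} := fun j =>
    measurableSet_lt measurable_const hY
  have upper : chq ν (fun ω => X ω + Y ω) ≤
      ∑ k ∈ Finset.range (2 * m), ν {ω | (k:ℝ) < X ω + Y ω} := by
    rw [chq_eq h (X := fun ω => X ω + Y ω) (hX.add hY) (a := 0) (b := (0:ℝ) + ((2 * m : ℕ) : ℝ)) le_rfl (by positivity)
      (fun ω => add_nonneg (hX0 ω) (hY0 ω))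
      (fun ω => by push_cast; linarith [hXm ω, hYm ω])]
    have := AntitoneOn.integral_le_sum (x₀ := 0) (a := 2 * m)
      ((h.antitone (X := fun ω => X ω + Y ω) (hX.add hY)).antitoneOn (Icc 0 (0 + ((2 * m : ℕ) : ℝ))))
    simp only [zero_add, add_zero] at this ⊢
    exact this
  have lower : ∀ V : Ω → ℝ, Measurable V → (∀ ω, 0 ≤ V ω) → (∀ ω, V ω ≤ m) →
      ∑ k ∈ Finset.range m, ν {ω | (k:ℝ) < V ω} ≤ chq ν V + 1 := by
    intro V hV hV0 hVm
    rw [chq_eq h hV (a := 0) (b := (0:ℝ) + (m : ℝ)) le_rfl (by positivity) hV0 (by simpa using hVm)]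
    have := AntitoneOn.sum_le_integral (x₀ := 0) (a := m)
      ((h.antitone hV).antitoneOn (Icc 0 (0 + (m : ℝ))))
    simp only [zero_add, add_zero] at this ⊢
    have h1 : ν {ω | ((0:ℕ):ℝ) < V ω} ≤ 1 := by
      rw [← h.univ]
      exact h.mono _ _ (measurableSet_lt measurable_const hV) MeasurableSet.univ (subset_univ _)
    have h0 : 0 ≤ ν {ω | ((m:ℕ):ℝ) < V ω} := by
      rw [← h.empty]
      exact h.mono _ _ MeasurableSet.empty (measurableSet_lt measurable_const hV) (empty_subset _)
    have e := Finset.sum_range_succ' (fun k : ℕ => ν {ω | (k:ℝ) < V ω}) m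
    rw [Finset.sum_range_succ] at e
    linarith
  have c1 := count_sum h hsub (fun _ => 0) measurable_const _ hXs (2 * m) m
  have c2 := count_sum h hsub
    (fun ω => 0 + ∑ j ∈ Finset.range m, ({ω | (j:ℝ) < X ω} : Set Ω).indicator (fun _ => 1) ω)
    (measurable_const.add (Finset.measurable_sum _ fun j _ => measurable_const.indicator (hXs j)))
    _ hYs (2 * m) m
  have z : ∑ k ∈ Finset.range (2 * m), ν {ω : Ω | k < 0} = 0 := by
    simp [h.empty]
  have mid : ∑ k ∈ Finset.range (2 * m), ν {ω | (k:ℝ) < X ω + Y ω} ≤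
      ∑ k ∈ Finset.range (2 * m), ν {ω | k <
        (0 + ∑ j ∈ Finset.range m, ({ω | (j:ℝ) < X ω} : Set Ω).indicator (fun _ => 1) ω) +
        ∑ j ∈ Finset.range m, ({ω | (j:ℝ) < Y ω} : Set Ω).indicator (fun _ => 1) ω} := by
    apply Finset.sum_le_sum
    intro k _
    apply h.mono
    · exact measurableSet_lt measurable_const (hX.add hY)
    · exact measurableSet_lt measurable_const ((measurable_const.add (Finset.measurable_sum _
        fun j _ => measurable_const.indicator (hXs j))).add (Finset.measurable_sum _
        fun j _ => measurable_const.indicator (hYs j)))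
    · intro ω hω
      have a1 := le_count (hXm ω)
      have a2 := le_count (hYm ω)
      simp only [mem_ofPred_eq, indicator_apply, zero_add] at hω ⊢
      have := hω.trans_le (add_le_add a1 a2)
      exact_mod_cast this
  have l1 := lower X hX hX0 hXm
  have l2 := lower Y hY hY0 hYm
  linarith

lemma chq_sub {Ω : Type*} [MeasurableSpace Ω] {ν : Set Ω → ℝ} (h : Capac ν)
    (hsub : ∀ A B, MeasurableSet A → MeasurableSet B → ν (A ∩ B) + ν (A ∪ B) ≤ ν A + ν B)
    {X Y : Ω → ℝ} (hX : BddRV X) (hY : BddRV Y) :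
    chq ν (fun ω => X ω + Y ω) ≤ chq ν X + chq ν Y := by
  obtain ⟨hXm, C, hC⟩ := id hX
  obtain ⟨hYm, D, hD⟩ := id hY
  have hXY : BddRV (fun ω => X ω + Y ω) :=
    ⟨hXm.add hYm, C + D, fun ω => (abs_add_le _ _).trans (add_le_add (hC ω) (hD ω))⟩
  have shift : ∀ {V : Ω → ℝ} (c : ℝ), BddRV V → BddRV (fun ω => V ω + c) := by
    rintro V c ⟨hV, E, hE⟩
    exact ⟨hV.add_const c, E + |c|, fun ω => (abs_add_le _ _).trans (by gcongr; exact hE ω)⟩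
  obtain ⟨R, hRC⟩ : ∃ R : ℕ, max C D ≤ R := exists_nat_ge _
  have key : ∀ n : ℕ, (n:ℝ) * (chq ν (fun ω => X ω + Y ω)) ≤ n * (chq ν X + chq ν Y) + 2 := by
    intro n
    have bX : ∀ ω, 0 ≤ X ω + R ∧ X ω + R ≤ 2 * R := fun ω => by
      have := abs_le.1 ((hC ω).trans ((le_max_left C D).trans hRC))
      constructor <;> linarith
    have bY : ∀ ω, 0 ≤ Y ω + R ∧ Y ω + R ≤ 2 * R := fun ω => by
      have := abs_le.1 ((hD ω).trans ((le_max_right C D).trans hRC))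
      constructor <;> linarith
    have hn : (0:ℝ) ≤ n := Nat.cast_nonneg n
    have := chq_sub_aux h hsub (X := fun ω => n * (X ω + R)) (Y := fun ω => n * (Y ω + R))
      ((hXm.add_const _).const_mul _) ((hYm.add_const _).const_mul _) (n * (2 * R))
      (fun ω => mul_nonneg hn (bX ω).1)
      (fun ω => by push_cast; exact mul_le_mul_of_nonneg_left (bX ω).2 hn)
      (fun ω => mul_nonneg hn (bY ω).1)
      (fun ω => by push_cast; exact mul_le_mul_of_nonneg_left (bY ω).2 hn)
    have e : (fun ω => n * (X ω + R) + n * (Y ω + R)) =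
        fun ω => n * ((X ω + Y ω) + ((R:ℝ) + R)) := by
      ext ω; ring
    rw [e, chq_mul h (shift _ hXY) n hn, chq_mul h (shift _ hX) n hn, chq_mul h (shift _ hY) n hn,
      chq_add_const h hXY, chq_add_const h hX, chq_add_const h hY] at this
    linarith
  by_contra hcon
  push Not at hcon
  obtain ⟨n, hn⟩ := exists_nat_gt (2 / (chq ν (fun ω => X ω + Y ω) - (chq ν X + chq ν Y)))
  rw [div_lt_iff₀ (by linarith)] at hn
  have := key n
  linarith

lemma chq_mono {Ω : Type*} [MeasurableSpace Ω] {ν : Set Ω → ℝ} (h : Capac ν)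
    {X Y : Ω → ℝ} (hX : BddRV X) (hY : BddRV Y)
    (hle : ∀ x, ν {ω | x < X ω} ≤ ν {ω | x < Y ω}) : chq ν X ≤ chq ν Y := by
  obtain ⟨hXm, C, hC⟩ := hX
  obtain ⟨hYm, D, hD⟩ := hY
  have bX : ∀ ω, -max |C| |D| ≤ X ω ∧ X ω ≤ max |C| |D| := fun ω =>
    abs_le.1 ((hC ω).trans ((le_abs_self C).trans (le_max_left _ _)))
  have bY : ∀ ω, -max |C| |D| ≤ Y ω ∧ Y ω ≤ max |C| |D| := fun ω =>
    abs_le.1 ((hD ω).trans ((le_abs_self D).trans (le_max_right _ _)))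
  have h0 : 0 ≤ max |C| |D| := (abs_nonneg C).trans (le_max_left _ _)
  rw [chq_eq h hXm (by linarith) h0 (fun ω => (bX ω).1) (fun ω => (bX ω).2),
    chq_eq h hYm (by linarith) h0 (fun ω => (bY ω).1) (fun ω => (bY ω).2)]
  gcongr
  exact intervalIntegral.integral_mono (by linarith) (h.antitone hXm).intervalIntegrable
    (h.antitone hYm).intervalIntegrable hle

lemma chq_ind {Ω : Type*} [MeasurableSpace Ω] {ν : Set Ω → ℝ} (h : Capac ν)
    {A B : Set Ω} (hA : MeasurableSet A) (hB : MeasurableSet B) :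
    chq ν (fun ω => A.indicator (fun _ => (1:ℝ)) ω + B.indicator (fun _ => (1:ℝ)) ω) =
      ν (A ∩ B) + ν (A ∪ B) := by
  have hm : Measurable (fun ω => A.indicator (fun _ => (1:ℝ)) ω + B.indicator (fun _ => (1:ℝ)) ω) :=
    (measurable_const.indicator hA).add (measurable_const.indicator hB)
  have i1 : ∀ (S : Set Ω) ω, 0 ≤ S.indicator (fun _ => (1:ℝ)) ω := fun S ω =>
    indicator_nonneg (by simp) _
  have i2 : ∀ (S : Set Ω) ω, S.indicator (fun _ => (1:ℝ)) ω ≤ 1 := fun S ω =>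
    indicator_le_self' (f := fun _ => (1:ℝ)) (by simp) _
  rw [chq_eq h hm (a := 0) (b := 2) le_rfl (by norm_num) (fun ω => add_nonneg (i1 _ _) (i1 _ _))
    (fun ω => by linarith [i2 A ω, i2 B ω]),
    ← intervalIntegral.integral_add_adjacent_intervals (b := 1)
      (h.antitone hm).intervalIntegrable (h.antitone hm).intervalIntegrable]
  have j1 : ∫ x in (0:ℝ)..1, ν {ω | x < A.indicator (fun _ => (1:ℝ)) ω +
      B.indicator (fun _ => (1:ℝ)) ω} = ν (A ∪ B) := by
    rw [intervalIntegral.integral_of_le (by norm_num), ← integral_Ico_eq_integral_Ioc,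
      setIntegral_congr_fun (g := fun _ => ν (A ∪ B)) measurableSet_Ico]
    · simp
    · intro x hx
      obtain ⟨hx0, hx1⟩ := hx
      simp only
      congr 1
      ext ω
      by_cases h1 : ω ∈ A <;> by_cases h2 : ω ∈ B <;> simp [h1, h2] <;> linarith
  have j2 : ∫ x in (1:ℝ)..2, ν {ω | x < A.indicator (fun _ => (1:ℝ)) ω +
      B.indicator (fun _ => (1:ℝ)) ω} = ν (A ∩ B) := by
    rw [intervalIntegral.integral_of_le (by norm_num), ← integral_Ico_eq_integral_Ioc,
      setIntegral_congr_fun (g := fun _ => ν (A ∩ B)) measurableSet_Ico]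
    · norm_num
    · intro x hx
      obtain ⟨hx0, hx1⟩ := hx
      simp only
      congr 1
      ext ω
      by_cases h1 : ω ∈ A <;> by_cases h2 : ω ∈ B <;> simp [h1, h2] <;> linarith
  rw [j1, j2]
  ring

lemma atomless_small {Ω : Type*} [MeasurableSpace Ω] {P : Measure Ω} [IsProbabilityMeasure P]
    (hP : Atomless P) {A : Set Ω} (hA : MeasurableSet A) (hpos : 0 < P.real A) {ε : ℝ}
    (hε : 0 < ε) : ∃ B, B ⊆ A ∧ MeasurableSet B ∧ 0 < P.real B ∧ P.real B ≤ ε := by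
  have key : ∀ n : ℕ, ∃ B, B ⊆ A ∧ MeasurableSet B ∧ 0 < P.real B ∧
      P.real B ≤ P.real A * (1 / 2) ^ n := by
    intro n
    induction n with
    | zero => exact ⟨A, subset_rfl, hA, hpos, by simp⟩
    | succ n ih =>
      obtain ⟨B, hBA, hB, hB0, hBn⟩ := ih
      obtain ⟨D, hDB, hD, hD0, hDlt⟩ := hP B hB (by
        rw [measureReal_def, ENNReal.toReal_pos_iff] at hB0; exact hB0.1)
      have r0 : 0 < P.real D := by
        rw [measureReal_def, ENNReal.toReal_pos_iff]; exact ⟨hD0, measure_lt_top _ _⟩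
      have rlt : P.real D < P.real B :=
        (ENNReal.toReal_lt_toReal (measure_ne_top _ _) (measure_ne_top _ _)).2 hDlt
      have rd : P.real (B \ D) = P.real B - P.real D := measureReal_sdiff hDB hD
      rcases le_total (P.real D) (P.real B / 2) with hh | hh
      · exact ⟨D, hDB.trans hBA, hD, r0, by rw [pow_succ]; linarith⟩
      · exact ⟨B \ D, sdiff_subset.trans hBA, hB.diff hD, by linarith, by rw [pow_succ]; linarith⟩
  obtain ⟨n, hn⟩ := exists_pow_lt_of_lt_one hε (show (1/2:ℝ) < 1 by norm_num)
  obtain ⟨B, h1, h2, h3, h4⟩ := key n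
  refine ⟨B, h1, h2, h3, h4.trans ?_⟩
  have : P.real A ≤ 1 := measureReal_le_one
  have : (0:ℝ) ≤ (1/2)^n := by positivity
  nlinarith

lemma atomless_sier {Ω : Type*} [MeasurableSpace Ω] {P : Measure Ω} [IsProbabilityMeasure P]
    (hP : Atomless P) {A : Set Ω} (hA : MeasurableSet A) {t : ℝ} (ht0 : 0 ≤ t)
    (htA : t ≤ P.real A) : ∃ B, B ⊆ A ∧ MeasurableSet B ∧ P.real B = t := by
  classical
  let S := {B : Set Ω // B ⊆ A ∧ MeasurableSet B ∧ P.real B ≤ t}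
  have step : ∀ B : S, ∃ B' : S, B.1 ⊆ B'.1 ∧ ∀ D : S, B.1 ⊆ D.1 →
      (P.real B.1 + P.real D.1) / 2 ≤ P.real B'.1 := by
    intro B
    set R : Set ℝ := {r | ∃ D : S, B.1 ⊆ D.1 ∧ r = P.real D.1} with hR
    have hbdd : BddAbove R := ⟨t, by rintro r ⟨D, _, rfl⟩; exact D.2.2.2⟩
    have hne : R.Nonempty := ⟨_, B, subset_rfl, rfl⟩
    have hBs : P.real B.1 ≤ sSup R := le_csSup hbdd ⟨B, subset_rfl, rfl⟩
    rcases hBs.eq_or_lt with he | hlt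
    · refine ⟨B, subset_rfl, fun D hD => ?_⟩
      have := le_csSup hbdd ⟨D, hD, rfl⟩
      linarith
    · obtain ⟨r, ⟨B', hB', rfl⟩, hr⟩ := exists_lt_of_lt_csSup hne
        (show (P.real B.1 + sSup R) / 2 < sSup R by linarith)
      refine ⟨B', hB', fun D hD => ?_⟩
      have := le_csSup hbdd ⟨D, hD, rfl⟩
      linarith
  choose nx hnx1 hnx2 using step
  let b : ℕ → S := fun n => Nat.rec ⟨∅, by simp, MeasurableSet.empty, by simpa using ht0⟩
    (fun _ B => nx B) n
  have hb : ∀ n, b (n + 1) = nx (b n) := fun n => rfl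
  have hmono : Monotone (fun n => (b n).1) :=
    monotone_nat_of_le_succ (fun n => by rw [hb]; exact hnx1 _)
  set U := ⋃ n, (b n).1 with hU
  have hUm : MeasurableSet U := MeasurableSet.iUnion fun n => (b n).2.2.1
  have hlim : Tendsto (fun n => P.real (b n).1) atTop (nhds (P.real U)) :=
    (ENNReal.tendsto_toReal (measure_ne_top _ _)).comp (tendsto_measure_iUnion_atTop hmono)
  have hUA : U ⊆ A := iUnion_subset fun n => (b n).2.1
  have hUt : P.real U ≤ t := le_of_tendsto' hlim fun n => (b n).2.2.2
  refine ⟨U, hUA, hUm, ?_⟩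
  by_contra hne
  have hlt : P.real U < t := lt_of_le_of_ne hUt hne
  have hd : P.real (A \ U) = P.real A - P.real U := measureReal_sdiff hUA hUm
  obtain ⟨D, hDA, hD, hD0, hDε⟩ := atomless_small hP (hA.diff hUm) (by linarith)
    (show 0 < t - P.real U by linarith)
  have hu : P.real (U ∪ D) = P.real U + P.real D :=
    measureReal_union (disjoint_of_subset_right hDA disjoint_sdiff_right) hD
  let E : S := ⟨U ∪ D, union_subset hUA (hDA.trans sdiff_subset), hUm.union hD, by linarith⟩
  have h1 : ∀ n, (P.real (b n).1 + P.real E.1) / 2 ≤ P.real (b (n+1)).1 := fun n =>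
    hnx2 (b n) E ((subset_iUnion (fun n => (b n).1) n).trans subset_union_left)
  have h2 := le_of_tendsto_of_tendsto' ((hlim.add_const (P.real E.1)).div_const 2)
    (hlim.comp (tendsto_add_atTop_nat 1)) h1
  have : P.real E.1 = P.real U + P.real D := hu
  linarith

lemma atomless_mid {Ω : Type*} [MeasurableSpace Ω] {P : Measure Ω} [IsProbabilityMeasure P]
    (hP : Atomless P) (A B : Set Ω) : ∃ C, MeasurableSet A → MeasurableSet B → A ⊆ B →
      MeasurableSet C ∧ A ⊆ C ∧ C ⊆ B ∧ P.real C = (P.real A + P.real B) / 2 := by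
  by_cases h : MeasurableSet A ∧ MeasurableSet B ∧ A ⊆ B
  · obtain ⟨hA, hB, hAB⟩ := h
    have hd : P.real (B \ A) = P.real B - P.real A := measureReal_sdiff hAB hA
    have h0 : 0 ≤ P.real (B \ A) := measureReal_nonneg
    obtain ⟨D, hDA, hD, hDe⟩ := atomless_sier hP (hB.diff hA) (t := P.real (B \ A) / 2)
      (by linarith) (by linarith)
    have hu : P.real (A ∪ D) = P.real A + P.real D :=
      measureReal_union (disjoint_of_subset_right hDA disjoint_sdiff_right) hD
    exact ⟨A ∪ D, fun _ _ _ => ⟨hA.union hD, subset_union_left,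
      union_subset hAB (hDA.trans sdiff_subset), by linarith⟩⟩
  · exact ⟨∅, fun h1 h2 h3 => absurd ⟨h1, h2, h3⟩ h⟩

lemma atomless_chain {Ω : Type*} [MeasurableSpace Ω] {P : Measure Ω} [IsProbabilityMeasure P]
    (hP : Atomless P) : ∃ s : ℕ → ℕ → Set Ω, (∀ n k, MeasurableSet (s n k)) ∧
      (∀ n, Monotone (s n)) ∧ (∀ n k, s (n + 1) (2 * k) = s n k) ∧
      (∀ n k, k ≤ 2 ^ n → P.real (s n k) = k / 2 ^ n) ∧ (s 0 1 = univ) := by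
  choose mid hmid using atomless_mid hP
  let s : ℕ → ℕ → Set Ω := fun n => Nat.rec (fun k => if k = 0 then ∅ else univ)
    (fun _ f j => if j % 2 = 0 then f (j / 2) else mid (f (j / 2)) (f (j / 2 + 1))) n
  have hs0 : ∀ k, s 0 k = if k = 0 then ∅ else univ := fun k => rfl
  have hs : ∀ n j, s (n + 1) j = if j % 2 = 0 then s n (j / 2) else
    mid (s n (j / 2)) (s n (j / 2 + 1)) := fun n j => rfl
  have key : ∀ n, (∀ k, MeasurableSet (s n k)) ∧ (Monotone (s n)) ∧
      (∀ k, k ≤ 2 ^ n → P.real (s n k) = k / 2 ^ n) := by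
    intro n
    induction n with
    | zero =>
      refine ⟨fun k => ?_, fun a b hab => ?_, fun k hk => ?_⟩
      · rw [hs0]; split_ifs <;> simp
      · rw [hs0, hs0]
        split_ifs with h1 h2
        · exact le_rfl
        · exact bot_le
        · omega
        · exact le_rfl
      · rw [hs0]
        simp only [pow_zero] at hk
        interval_cases k <;> simp
    | succ n ih =>
      obtain ⟨i1, i2, i3⟩ := ih
      have hm : ∀ k, _ := fun k => hmid (s n k) (s n (k+1)) (i1 _) (i1 _) (i2 (Nat.le_succ k))
      refine ⟨fun k => ?_, monotone_nat_of_le_succ fun k => ?_, fun k hk => ?_⟩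
      · rw [hs]; split_ifs
        · exact i1 _
        · exact (hm _).1
      · rw [hs, hs]
        rcases Nat.even_or_odd' k with ⟨c, rfl | rfl⟩
        · have e1 : (2 * c) % 2 = 0 := by omega
          have e2 : ¬ (2 * c + 1) % 2 = 0 := by omega
          have e3 : (2 * c) / 2 = c := by omega
          have e4 : (2 * c + 1) / 2 = c := by omega
          rw [if_pos e1, if_neg e2, e3, e4]
          exact (hm c).2.1
        · have e1 : (2 * c + 1 + 1) % 2 = 0 := by omega
          have e2 : ¬ (2 * c + 1) % 2 = 0 := by omega
          have e3 : (2 * c + 1 + 1) / 2 = c + 1 := by omega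
          have e4 : (2 * c + 1) / 2 = c := by omega
          rw [if_pos e1, if_neg e2, e3, e4]
          exact (hm c).2.2.1
      · rw [hs]
        rw [pow_succ] at hk
        rcases Nat.even_or_odd' k with ⟨c, rfl | rfl⟩
        · have e1 : (2 * c) % 2 = 0 := by omega
          have e3 : (2 * c) / 2 = c := by omega
          rw [if_pos e1, e3, i3 c (by omega), pow_succ]
          push_cast
          field_simp
        · have e2 : ¬ (2 * c + 1) % 2 = 0 := by omega
          have e4 : (2 * c + 1) / 2 = c := by omega
          rw [if_neg e2, e4, (hm c).2.2.2, i3 c (by omega), i3 (c+1) (by omega), pow_succ]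
          push_cast
          field_simp
          ring
  refine ⟨s, fun n => (key n).1, fun n => (key n).2.1, fun n k => ?_, fun n => (key n).2.2, ?_⟩
  · rw [hs, if_pos (by omega)]
    congr 1
    omega
  · rw [hs0]; simp

lemma atomless_uniform {Ω : Type*} [MeasurableSpace Ω] {P : Measure Ω} [IsProbabilityMeasure P]
    (hP : Atomless P) : ∃ U : Ω → unitInterval, Measurable U ∧ P.map U = volume := by
  obtain ⟨s, hsm, hmono, hs2, hsP, hs1⟩ := atomless_chain hP
  have hpow : ∀ d n k, s (n + d) (k * 2 ^ d) = s n k := by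
    intro d n k
    induction d with
    | zero => simp
    | succ d ih =>
      rw [← add_assoc, pow_succ, show k * (2 ^ d * 2) = 2 * (k * 2 ^ d) by ring, hs2, ih]
  have hcmp : ∀ n k m j : ℕ, (k:ℝ) / 2 ^ n ≤ j / 2 ^ m → s n k ⊆ s m j := by
    intro n k m j h
    rw [← hpow m n k, ← hpow n m j, add_comm m n]
    apply hmono
    rw [div_le_div_iff₀ (by positivity) (by positivity)] at h
    exact_mod_cast h
  let T : Ω → Set ℝ := fun ω => {r | ∃ n k : ℕ, ω ∈ s n k ∧ r = (k:ℝ) / 2 ^ n}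
  have hT0 : ∀ ω, ∀ r ∈ T ω, 0 ≤ r := by
    rintro ω r ⟨n, k, _, rfl⟩; positivity
  have hTb : ∀ ω, BddBelow (T ω) := fun ω => ⟨0, hT0 ω⟩
  have hT1 : ∀ ω, (1:ℝ) ∈ T ω := fun ω => ⟨0, 1, by rw [hs1]; trivial, by simp⟩
  let V : Ω → ℝ := fun ω => sInf (T ω)
  have hV0 : ∀ ω, 0 ≤ V ω := fun ω => le_csInf ⟨1, hT1 ω⟩ (hT0 ω)
  have hV1 : ∀ ω, V ω ≤ 1 := fun ω => csInf_le (hTb ω) (hT1 ω)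
  have hlt : ∀ a : ℝ, {ω | V ω < a} = ⋃ (n : ℕ) (k : ℕ) (_ : (k:ℝ) / 2 ^ n < a), s n k := by
    intro a
    ext ω
    simp only [mem_ofPred_eq, mem_iUnion]
    constructor
    · intro h
      obtain ⟨r, ⟨n, k, hk, rfl⟩, hr⟩ := exists_lt_of_csInf_lt ⟨1, hT1 ω⟩ h
      exact ⟨n, k, hr, hk⟩
    · rintro ⟨n, k, hr, hk⟩
      exact (csInf_le (hTb ω) ⟨n, k, hk, rfl⟩).trans_lt hr
  have hVm : Measurable V := by
    apply measurable_of_Iio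
    intro a
    have : V ⁻¹' Iio a = {ω | V ω < a} := rfl
    rw [this, hlt]
    exact MeasurableSet.iUnion fun n => MeasurableSet.iUnion fun k => MeasurableSet.iUnion fun _ =>
      hsm n k
  have hpr : ∀ a : ℝ, 0 ≤ a → a ≤ 1 → P.real {ω | V ω < a} = a := by
    intro a ha0 ha1
    have lim : Tendsto (fun n : ℕ => ((1:ℝ)/2) ^ n) atTop (nhds 0) :=
      tendsto_pow_atTop_nhds_zero_of_lt_one (by norm_num) (by norm_num)
    apply le_antisymm
    · have : ∀ n : ℕ, P.real {ω | V ω < a} ≤ a + (1/2) ^ n := by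
        intro n
        have hc := Nat.ceil_lt_add_one (show 0 ≤ a * 2 ^ n by positivity)
        have hle := Nat.le_ceil (a * 2 ^ n)
        have hsub : {ω | V ω < a} ⊆ s n ⌈a * 2 ^ n⌉₊ := by
          rw [hlt]
          refine iUnion_subset fun m => iUnion_subset fun k => iUnion_subset fun hk => ?_
          apply hcmp
          refine hk.le.trans ?_
          rw [le_div_iff₀ (by positivity)]
          exact hle
        refine (measureReal_mono hsub).trans ?_
        rw [hsP]
        · rw [div_le_iff₀ (by positivity), add_mul, ← mul_pow]
          norm_num
          linarith
        · rw [Nat.ceil_le]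
          push_cast
          have : (0:ℝ) < 2 ^ n := by positivity
          nlinarith
      have h2 := ge_of_tendsto' (lim.const_add a) this
      simpa using h2
    · have : ∀ n : ℕ, a - 1 * (1/2) ^ n ≤ P.real {ω | V ω < a} := by
        intro n
        rcases le_or_gt (a * 2 ^ n) 0 with h0 | h0
        · have : a ≤ 0 := by
            by_contra hcon
            push Not at hcon
            have : (0:ℝ) < a * 2 ^ n := by positivity
            linarith
          have h3 : (0:ℝ) ≤ (1/2)^n := by positivity
          have h4 : 0 ≤ P.real {ω | V ω < a} := measureReal_nonneg
          linarith
        · have hc := Nat.ceil_lt_add_one (show 0 ≤ a * 2 ^ n by positivity)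
          have hle := Nat.le_ceil (a * 2 ^ n)
          have hp : 0 < ⌈a * 2 ^ n⌉₊ := Nat.ceil_pos.2 h0
          obtain ⟨k, hk⟩ : ∃ k, ⌈a * 2 ^ n⌉₊ = k + 1 := ⟨_, (Nat.succ_pred_eq_of_pos hp).symm⟩
          rw [hk] at hc hle
          push_cast at hc hle
          have hka : (k:ℝ) / 2 ^ n < a := by
            rw [div_lt_iff₀ (by positivity)]; linarith
          have hsub : s n k ⊆ {ω | V ω < a} := by
            rw [hlt]
            intro ω hω
            simp only [mem_iUnion]
            exact ⟨n, k, hka, hω⟩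
          refine le_trans ?_ (measureReal_mono hsub)
          rw [hsP]
          · rw [le_div_iff₀ (by positivity), sub_mul, mul_assoc, ← mul_pow]
            norm_num
            linarith
          · have h5 : (k:ℝ) < 2 ^ n := by
              rw [div_lt_iff₀ (by positivity)] at hka
              have : (0:ℝ) < 2 ^ n := by positivity
              nlinarith
            exact_mod_cast h5.le
      have h2 := le_of_tendsto' ((lim.const_mul 1).const_sub a) this
      simpa using h2
  have hUm : Measurable (fun ω => (⟨V ω, hV0 ω, hV1 ω⟩ : unitInterval)) := hVm.subtype_mk
  refine ⟨fun ω => ⟨V ω, hV0 ω, hV1 ω⟩, hUm, ?_⟩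
  have : IsProbabilityMeasure (P.map (fun ω => (⟨V ω, hV0 ω, hV1 ω⟩ : unitInterval))) :=
    Measure.isProbabilityMeasure_map hUm.aemeasurable
  apply Measure.ext_of_Ici
  intro a
  rw [Measure.map_apply hUm measurableSet_Ici, unitInterval.volume_Ici]
  have e : (fun ω => (⟨V ω, hV0 ω, hV1 ω⟩ : unitInterval)) ⁻¹' Ici a = {ω | V ω < a}ᶜ := by
    ext ω
    simp only [mem_preimage, mem_Ici, mem_compl_iff, mem_ofPred_eq, not_lt]
    rfl
  rw [e, ← ofReal_measureReal, probReal_compl_eq_one_sub (measurableSet_lt hVm measurable_const),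
    hpr a a.2.1 a.2.2]

def IsVer {Ω : Type*} [MeasurableSpace Ω] {N : ℕ} (P : Measure Ω) (W : Ω → (Fin N → ℝ))
    (A : Set Ω) (h : (Fin N → ℝ) → ℝ) : Prop :=
  InDstar h ∧ ∀ S : Set (Fin N → ℝ), MeasurableSet S →
    P (A ∩ W ⁻¹' S) = ∫⁻ w in S, ENNReal.ofReal (h w) ∂(P.map W)

lemma isVer_le {Ω : Type*} [MeasurableSpace Ω] {N : ℕ} {P : Measure Ω} [IsProbabilityMeasure P]
    {W : Ω → (Fin N → ℝ)} {A B : Set Ω} {h k : (Fin N → ℝ) → ℝ}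
    (hA : IsVer P W A h) (hB : IsVer P W B k) (hAB : ∀ᵐ ω ∂P, ω ∈ A → ω ∈ B) :
    ∀ᵐ w ∂(P.map W), h w ≤ k w := by
  have : (fun w => ENNReal.ofReal (h w)) ≤ᵐ[P.map W] (fun w => ENNReal.ofReal (k w)) := by
    apply ae_le_of_forall_setLIntegral_le_of_sigmaFinite hA.1.1.ennreal_ofReal
    intro S hS _
    rw [← hA.2 S hS, ← hB.2 S hS]
    apply measure_mono_ae
    filter_upwards [hAB] with ω hω h1
    exact ⟨hω h1.1, h1.2⟩
  filter_upwards [this] with w hw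
  exact (ENNReal.ofReal_le_ofReal_iff (hB.1.2 w).1).1 hw

lemma isVer_modular {Ω : Type*} [MeasurableSpace Ω] {N : ℕ} {P : Measure Ω}
    [IsProbabilityMeasure P] {W : Ω → (Fin N → ℝ)} (hW : Measurable W) {A B : Set Ω}
    (mB : MeasurableSet B)
    {h k i u : (Fin N → ℝ) → ℝ} (hA : IsVer P W A h) (hB : IsVer P W B k)
    (hI : IsVer P W (A ∩ B) i) (hU : IsVer P W (A ∪ B) u) :
    ∀ᵐ w ∂(P.map W), i w + u w = h w + k w := by
  have : (fun w => ENNReal.ofReal (i w) + ENNReal.ofReal (u w)) =ᵐ[P.map W]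
      (fun w => ENNReal.ofReal (h w) + ENNReal.ofReal (k w)) := by
    apply ae_eq_of_forall_setLIntegral_eq_of_sigmaFinite
      (hI.1.1.ennreal_ofReal.add hU.1.1.ennreal_ofReal)
      (hA.1.1.ennreal_ofReal.add hB.1.1.ennreal_ofReal)
    intro S hS _
    simp only [Pi.add_apply]
    rw [lintegral_add_left hI.1.1.ennreal_ofReal, lintegral_add_left hA.1.1.ennreal_ofReal,
      ← hA.2 S hS, ← hB.2 S hS, ← hI.2 S hS, ← hU.2 S hS, union_inter_distrib_right,
      inter_inter_distrib_right, add_comm]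
    exact measure_union_add_inter _ (mB.inter (hW hS))
  filter_upwards [this] with w hw
  rw [← ENNReal.ofReal_add (hI.1.2 w).1 (hU.1.2 w).1,
    ← ENNReal.ofReal_add (hA.1.2 w).1 (hB.1.2 w).1] at hw
  exact (ENNReal.ofReal_eq_ofReal_iff (add_nonneg (hI.1.2 w).1 (hU.1.2 w).1)
    (add_nonneg (hA.1.2 w).1 (hB.1.2 w).1)).1 hw

lemma isCondDistrib_exists {Ω : Type*} [MeasurableSpace Ω] {N : ℕ} {P : Measure Ω}
    [IsProbabilityMeasure P] {W : Ω → (Fin N → ℝ)} (hW : Measurable W) {X : Ω → ℝ}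
    (hX : Measurable X) : ∃ K : Kernel (Fin N → ℝ) ℝ, IsCondDistrib P X W K := by
  refine ⟨condDistrib X W P, inferInstance, fun B hB S hS => ?_⟩
  have h1 := compProd_map_condDistrib (mβ := inferInstance) (X := W) (Y := X) (μ := P) hX.aemeasurable
  have h2 := congrArg (fun m => m (S ×ˢ B)) h1
  rw [Measure.compProd_apply_prod hS hB, Measure.map_apply (hW.prodMk hX) (hS.prod hB)] at h2
  rw [h2]
  congr 1
  ext ω
  simp [and_comm]

lemma isVer_of_cond {Ω : Type*} [MeasurableSpace Ω] {N : ℕ} {P : Measure Ω}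
    [IsProbabilityMeasure P] {W : Ω → (Fin N → ℝ)} {X : Ω → ℝ}
    {K : Kernel (Fin N → ℝ) ℝ} (hK : IsCondDistrib P X W K) (x : ℝ) :
    IsVer P W {ω | x < X ω} (fun w => 1 - (K w (Iic x)).toReal) := by
  obtain ⟨hM, hK⟩ := hK
  have e : ∀ w, 1 - (K w (Iic x)).toReal = (K w (Ioi x)).toReal := fun w => by
    have := probReal_compl_eq_one_sub (μ := K w) (measurableSet_Iic (a := x))
    rw [compl_Iic] at this
    exact this.symm
  simp only [e]
  refine ⟨⟨(Kernel.measurable_coe K measurableSet_Ioi).ennreal_toReal, fun w =>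
    ⟨ENNReal.toReal_nonneg, measureReal_le_one⟩⟩, fun S hS => ?_⟩
  simp only [ENNReal.ofReal_toReal (measure_ne_top _ _)]
  exact hK (Ioi x) measurableSet_Ioi S hS

lemma isVer_exists {Ω : Type*} [MeasurableSpace Ω] {N : ℕ} {P : Measure Ω}
    [IsProbabilityMeasure P] {W : Ω → (Fin N → ℝ)} (hW : Measurable W) {A : Set Ω}
    (hA : MeasurableSet A) : ∃ h, IsVer P W A h := by
  obtain ⟨K, hK⟩ := isCondDistrib_exists (P := P) hW
    ((measurable_const (a := (1:ℝ))).indicator hA)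
  have := isVer_of_cond hK 0
  have e : {ω | (0:ℝ) < A.indicator (fun _ => 1) ω} = A := by
    ext ω
    by_cases h : ω ∈ A <;> simp [h]
  rw [e] at this
  exact ⟨_, this⟩

open Classical in
def nuW {Ω : Type*} [MeasurableSpace Ω] {N : ℕ} (P : Measure Ω) (W : Ω → (Fin N → ℝ))
    (G : ((Fin N → ℝ) → ℝ) → ℝ) (A : Set Ω) : ℝ :=
  if h : ∃ h, IsVer P W A h then G h.choose else 0

lemma nuW_eq {Ω : Type*} [MeasurableSpace Ω] {N : ℕ} {P : Measure Ω} [IsProbabilityMeasure P]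
    {W : Ω → (Fin N → ℝ)} {G : ((Fin N → ℝ) → ℝ) → ℝ} (hG : MonotoneFunctional (P.map W) G)
    {A : Set Ω} {h : (Fin N → ℝ) → ℝ} (hA : IsVer P W A h) : nuW P W G A = G h := by
  have hex : ∃ h, IsVer P W A h := ⟨h, hA⟩
  rw [nuW, dif_pos hex]
  apply le_antisymm
  · exact hG.2.2.2 _ _ hA.1 hex.choose_spec.1 (isVer_le hex.choose_spec hA (by simp))
  · exact hG.2.2.2 _ _ hex.choose_spec.1 hA.1 (isVer_le hA hex.choose_spec (by simp))

lemma nuW_mono {Ω : Type*} [MeasurableSpace Ω] {N : ℕ} {P : Measure Ω} [IsProbabilityMeasure P]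
    {W : Ω → (Fin N → ℝ)} (hW : Measurable W)
    {G : ((Fin N → ℝ) → ℝ) → ℝ} (hG : MonotoneFunctional (P.map W) G)
    {A B : Set Ω} (hA : MeasurableSet A) (hB : MeasurableSet B)
    (hAB : ∀ᵐ ω ∂P, ω ∈ A → ω ∈ B) : nuW P W G A ≤ nuW P W G B := by
  obtain ⟨h, hh⟩ := isVer_exists (P := P) hW hA
  obtain ⟨k, hk⟩ := isVer_exists (P := P) hW hB
  rw [nuW_eq hG hh, nuW_eq hG hk]
  exact hG.2.2.2 _ _ hk.1 hh.1 (isVer_le hh hk hAB)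

lemma nuW_capac {Ω : Type*} [MeasurableSpace Ω] {N : ℕ} {P : Measure Ω} [IsProbabilityMeasure P]
    {W : Ω → (Fin N → ℝ)} (hW : Measurable W)
    {G : ((Fin N → ℝ) → ℝ) → ℝ} (hG : MonotoneFunctional (P.map W) G) : Capac (nuW P W G) := by
  refine ⟨fun A B hA hB hAB => nuW_mono hW hG hA hB (ae_of_all _ hAB), ?_, ?_⟩
  · rw [nuW_eq hG (h := fun _ => 0) ⟨⟨measurable_const, by simp⟩, by simp⟩]
    exact hG.2.1
  · rw [nuW_eq hG (h := fun _ => 1) ⟨⟨measurable_const, by simp⟩, fun S hS => by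
      simp [Measure.map_apply hW hS]⟩]
    exact hG.2.2.1

lemma distortion_eq {Ω : Type*} [MeasurableSpace Ω] {N : ℕ} {P : Measure Ω}
    [IsProbabilityMeasure P]
    {W : Ω → (Fin N → ℝ)} {G : ((Fin N → ℝ) → ℝ) → ℝ} (hG : MonotoneFunctional (P.map W) G)
    {X : Ω → ℝ} {K : Kernel (Fin N → ℝ) ℝ} (hK : IsCondDistrib P X W K) :
    distortionRM G K = chq (nuW P W G) X := by
  simp only [distortionRM, chq, nuW_eq hG (isVer_of_cond hK _)]

lemma nuW_submod {Ω : Type*} [MeasurableSpace Ω] {N : ℕ} {P : Measure Ω} [IsProbabilityMeasure P]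
    {W : Ω → (Fin N → ℝ)} (hW : Measurable W)
    {G : ((Fin N → ℝ) → ℝ) → ℝ} (hG : MonotoneFunctional (P.map W) G)
    (hcA : ∀ f₁ f₂ g₁ g₂ : (Fin N → ℝ) → ℝ,
        InDstar f₁ → InDstar f₂ → InDstar g₁ → InDstar g₂ →
        (∀ w, g₁ w ≤ f₁ w) → (∀ w, g₁ w ≤ f₂ w) →
        (∀ w, f₁ w ≤ g₂ w) → (∀ w, f₂ w ≤ g₂ w) →
        (∀ w, f₁ w + f₂ w = g₁ w + g₂ w) →
        G g₁ + G g₂ ≤ G f₁ + G f₂)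
    (A B : Set Ω) (hA : MeasurableSet A) (hB : MeasurableSet B) :
    nuW P W G (A ∩ B) + nuW P W G (A ∪ B) ≤ nuW P W G A + nuW P W G B := by
  obtain ⟨f₁, h1⟩ := isVer_exists (P := P) hW hA
  obtain ⟨f₂, h2⟩ := isVer_exists (P := P) hW hB
  obtain ⟨i, hi⟩ := isVer_exists (P := P) hW (hA.inter hB)
  obtain ⟨u, hu⟩ := isVer_exists (P := P) hW (hA.union hB)
  have hmod := isVer_modular hW hB h1 h2 hi hu
  have l1 := isVer_le hi h1 (ae_of_all _ fun ω h => h.1)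
  have l2 := isVer_le hi h2 (ae_of_all _ fun ω h => h.2)
  rw [nuW_eq hG h1, nuW_eq hG h2, nuW_eq hG hi, nuW_eq hG hu]
  set g₁ : (Fin N → ℝ) → ℝ := fun w => max (min (i w) (min (f₁ w) (f₂ w))) (f₁ w + f₂ w - 1)
    with hg₁
  have a1 : ∀ w, g₁ w ≤ f₁ w := fun w => max_le ((min_le_right _ _).trans (min_le_left _ _))
    (by linarith [(h2.1.2 w).2])
  have a2 : ∀ w, g₁ w ≤ f₂ w := fun w => max_le ((min_le_right _ _).trans (min_le_right _ _))
    (by linarith [(h1.1.2 w).2])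
  have a3 : ∀ w, 0 ≤ g₁ w := fun w =>
    (le_min (hi.1.2 w).1 (le_min (h1.1.2 w).1 (h2.1.2 w).1)).trans (le_max_left _ _)
  have a4 : ∀ w, f₁ w + f₂ w - 1 ≤ g₁ w := fun w => le_max_right _ _
  have m1 : Measurable g₁ :=
    (hi.1.1.min (h1.1.1.min h2.1.1)).max ((h1.1.1.add h2.1.1).sub_const 1)
  have D1 : InDstar g₁ := ⟨m1, fun w => ⟨a3 w, (a1 w).trans (h1.1.2 w).2⟩⟩
  have D2 : InDstar (fun w => f₁ w + f₂ w - g₁ w) :=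
    ⟨(h1.1.1.add h2.1.1).sub m1, fun w => ⟨by linarith [a1 w, (h2.1.2 w).1], by linarith [a4 w]⟩⟩
  have key := hcA f₁ f₂ g₁ (fun w => f₁ w + f₂ w - g₁ w) h1.1 h2.1 D1 D2 a1 a2
    (fun w => by linarith [a2 w]) (fun w => by linarith [a1 w]) (fun w => by ring)
  have eg : ∀ᵐ w ∂(P.map W), g₁ w = i w := by
    filter_upwards [hmod, l1, l2] with w e1 e2 e3
    rw [hg₁]
    simp only
    rw [min_eq_left (le_min e2 e3), max_eq_left (by linarith [(hu.1.2 w).2])]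
  have k1 : G i ≤ G g₁ := hG.2.2.2 _ _ D1 hi.1 (by filter_upwards [eg] with w h; exact h.ge)
  have k2 : G u ≤ G (fun w => f₁ w + f₂ w - g₁ w) := hG.2.2.2 _ _ D2 hu.1 (by
    filter_upwards [eg, hmod] with w h h'; linarith)
  linarith

lemma exists_pair {Ω : Type*} [MeasurableSpace Ω] {N : ℕ} {P : Measure Ω} [IsProbabilityMeasure P]
    (hP : Atomless P) {W : Ω → (Fin N → ℝ)} (hW : Measurable W) :
    ∃ (W' : Ω → (Fin N → ℝ)) (U : Ω → unitInterval), Measurable W' ∧ Measurable U ∧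
      P.map (fun ω => (W' ω, U ω)) = (P.map W).prod volume := by
  obtain ⟨V, hV, hVl⟩ := atomless_uniform hP
  have : IsProbabilityMeasure (P.map W) := Measure.isProbabilityMeasure_map hW.aemeasurable
  obtain ⟨f, hf, hfl⟩ := Measure.exists_measurable_map_eq
    ((P.map W).prod (volume : Measure unitInterval))
  refine ⟨fun ω => (f (V ω)).1, fun ω => (f (V ω)).2, (hf.comp hV).fst, (hf.comp hV).snd, ?_⟩
  rw [← hfl, ← hVl, Measure.map_map hf hV]
  rfl

lemma isVer_U {Ω : Type*} [MeasurableSpace Ω] {N : ℕ} {P : Measure Ω} [IsProbabilityMeasure P]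
    {μ : Measure (Fin N → ℝ)} [IsProbabilityMeasure μ] {W : Ω → (Fin N → ℝ)} {U : Ω → unitInterval}
    (hW : Measurable W) (hU : Measurable U)
    (hl : P.map (fun ω => (W ω, U ω)) = μ.prod volume) (hμ : P.map W = μ)
    {f : (Fin N → ℝ) → ℝ} (hf : InDstar f) : IsVer P W {ω | (U ω : ℝ) < f (W ω)} f := by
  refine ⟨hf, fun S hS => ?_⟩
  set E : Set ((Fin N → ℝ) × unitInterval) := {p | (p.2 : ℝ) < f p.1} ∩ Prod.fst ⁻¹' S with hE
  have hEm : MeasurableSet E :=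
    (measurableSet_lt (measurable_subtype_coe.comp measurable_snd)
      (hf.1.comp measurable_fst)).inter (measurable_fst hS)
  have e1 : {ω | (U ω : ℝ) < f (W ω)} ∩ W ⁻¹' S = (fun ω => (W ω, U ω)) ⁻¹' E := rfl
  rw [e1, ← Measure.map_apply (hW.prodMk hU) hEm, hl, Measure.prod_apply hEm, hμ,
    ← lintegral_indicator hS]
  congr 1
  ext w
  by_cases hw : w ∈ S
  · rw [indicator_of_mem hw]
    have : Prod.mk w ⁻¹' E = Iio (⟨f w, hf.2 w⟩ : unitInterval) := by
      ext u
      simp only [hE, mem_preimage, mem_inter_iff, mem_ofPred_eq, hw, and_true, mem_Iio]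
      rfl
    rw [this, unitInterval.volume_Iio]
  · rw [indicator_of_notMem hw]
    have : Prod.mk w ⁻¹' E = ∅ := by
      ext u
      simp [hE, hw]
    rw [this, measure_empty]

lemma bddRV_ind {Ω : Type*} [MeasurableSpace Ω] {A : Set Ω} (hA : MeasurableSet A) :
    BddRV (A.indicator (fun _ => (1:ℝ))) :=
  ⟨measurable_const.indicator hA, 1, fun ω => by by_cases h : ω ∈ A <;> simp [h]⟩


/-- **Proposition (coherence ⇔ Condition A).** A distortion factor risk measure with a
law-invariant family of monotone functionals `{G_W}` is coherent iff `{G_W}` satisfies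
Condition A. -/
theorem stmt6 {Ω : Type*} [MeasurableSpace Ω] (P : Measure Ω) [IsProbabilityMeasure P]
    (hatomless : Atomless P) {N : ℕ} (hN : 1 ≤ N)
    (G : (Ω → (Fin N → ℝ)) → ((Fin N → ℝ) → ℝ) → ℝ)
    (hGmono : ∀ W : Ω → (Fin N → ℝ), Measurable W → MonotoneFunctional (P.map W) (G W))
    (hGlaw : ∀ W W' : Ω → (Fin N → ℝ), Measurable W → Measurable W' →
      P.map W = P.map W' → G W = G W')
    (ρ : (Ω → ℝ) → (Ω → (Fin N → ℝ)) → ℝ)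
    (hρ : ∀ X W, BddRV X → Measurable W → ∀ K : Kernel (Fin N → ℝ) ℝ,
      IsCondDistrib P X W K → ρ X W = distortionRM (G W) K) :
    -- `ρ` is a coherent factor risk measure
    ((∀ W : Ω → (Fin N → ℝ), Measurable W →
      (∀ X Y, BddRV X → BddRV Y → (∀ᵐ ω ∂P, X ω ≤ Y ω) → ρ X W ≤ ρ Y W) ∧
      (∀ X (c : ℝ), BddRV X → ρ (fun ω => X ω + c) W = ρ X W + c) ∧
      (∀ X (l : ℝ), BddRV X → 0 ≤ l → ρ (fun ω => l * X ω) W = l * ρ X W) ∧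
      (∀ X Y, BddRV X → BddRV Y → ρ (X + Y) W ≤ ρ X W + ρ Y W)))
    ↔
    -- Condition A
    (∀ W : Ω → (Fin N → ℝ), Measurable W →
      ∀ f₁ f₂ g₁ g₂ : (Fin N → ℝ) → ℝ,
        InDstar f₁ → InDstar f₂ → InDstar g₁ → InDstar g₂ →
        (∀ w, g₁ w ≤ f₁ w) → (∀ w, g₁ w ≤ f₂ w) →
        (∀ w, f₁ w ≤ g₂ w) → (∀ w, f₂ w ≤ g₂ w) →
        (∀ w, f₁ w + f₂ w = g₁ w + g₂ w) →
        G W g₁ + G W g₂ ≤ G W f₁ + G W f₂) := by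
  have hrep : ∀ X W, BddRV X → Measurable W → ρ X W = chq (nuW P W (G W)) X := by
    intro X W hX hW
    obtain ⟨K, hK⟩ := isCondDistrib_exists (P := P) hW hX.1
    rw [hρ X W hX hW K hK, distortion_eq (hGmono W hW) hK]
  have hadd : ∀ X Y : Ω → ℝ, BddRV X → BddRV Y → BddRV (fun ω => X ω + Y ω) := by
    rintro X Y ⟨hX, C, hC⟩ ⟨hY, D, hD⟩
    exact ⟨hX.add hY, C + D, fun ω => (abs_add_le _ _).trans (add_le_add (hC ω) (hD ω))⟩
  constructor
  · intro hcoh W hW f₁ f₂ g₁ g₂ hf₁ hf₂ hg₁ hg₂ h11 h12 h21 h22 hsum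
    obtain ⟨W', U, hW', hU, hl⟩ := exists_pair hatomless hW
    have : IsProbabilityMeasure (P.map W) := Measure.isProbabilityMeasure_map hW.aemeasurable
    have hlaw : P.map W' = P.map W := by
      have h1 := congrArg (Measure.map Prod.fst) hl
      rw [Measure.map_map measurable_fst (hW'.prodMk hU), Measure.map_fst_prod] at h1
      simp only [measure_univ, one_smul] at h1
      exact h1
    rw [← hGlaw W' W hW' hW hlaw]
    have hG := hGmono W' hW'
    have hc := nuW_capac hW' hG
    have ver : ∀ {f}, InDstar f → IsVer P W' {ω | (U ω : ℝ) < f (W' ω)} f := fun hf =>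
      isVer_U hW' hU hl hlaw hf
    have ms : ∀ {f : (Fin N → ℝ) → ℝ}, InDstar f → MeasurableSet {ω | (U ω : ℝ) < f (W' ω)} :=
      fun hf => measurableSet_lt (measurable_subtype_coe.comp hU) (hf.1.comp hW')
    set A : Set Ω := {ω | (U ω : ℝ) < f₁ (W' ω)} with hA
    set B : Set Ω := {ω | (U ω : ℝ) < g₁ (W' ω)} ∪
      ({ω | (U ω : ℝ) < g₂ (W' ω)} \ {ω | (U ω : ℝ) < f₁ (W' ω)}) with hB
    have mA : MeasurableSet A := ms hf₁
    have mB : MeasurableSet B := (ms hg₁).union ((ms hg₂).diff (ms hf₁))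
    have eI : A ∩ B = {ω | (U ω : ℝ) < g₁ (W' ω)} := by
      ext ω
      have := h11 (W' ω)
      simp only [hA, hB, mem_inter_iff, mem_union, Set.mem_sdiff, mem_ofPred_eq]
      constructor
      · rintro ⟨a, b | b⟩
        · exact b
        · exact absurd a b.2
      · intro h
        exact ⟨by linarith, Or.inl h⟩
    have eU : A ∪ B = {ω | (U ω : ℝ) < g₂ (W' ω)} := by
      ext ω
      have := h11 (W' ω)
      have := h21 (W' ω)
      simp only [hA, hB, mem_union, Set.mem_sdiff, mem_ofPred_eq]
      constructor
      · rintro (a | b | b)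
        · linarith
        · linarith
        · exact b.1
      · intro h
        by_cases h' : (U ω : ℝ) < f₁ (W' ω)
        · exact Or.inl h'
        · exact Or.inr (Or.inr ⟨h, h'⟩)
    have vI : IsVer P W' (A ∩ B) g₁ := by rw [eI]; exact ver hg₁
    have vU : IsVer P W' (A ∪ B) g₂ := by rw [eU]; exact ver hg₂
    obtain ⟨k, hk⟩ := isVer_exists (P := P) hW' mB
    have hmod := isVer_modular hW' mB (ver hf₁) hk vI vU
    have hkf : G W' k ≤ G W' f₂ := hG.2.2.2 _ _ hf₂ hk.1 (by
      filter_upwards [hmod] with w hw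
      linarith [hsum w])
    have ind1 : ∀ S : Set Ω, MeasurableSet S →
        chq (nuW P W' (G W')) (S.indicator (fun _ => (1:ℝ))) = nuW P W' (G W') S := by
      intro S hS
      have := chq_ind hc hS MeasurableSet.empty
      simpa [hc.empty] using this
    have hs := (hcoh W' hW').2.2.2 _ _ (bddRV_ind mA) (bddRV_ind mB)
    have e0 : (A.indicator (fun _ => (1:ℝ)) + B.indicator (fun _ => (1:ℝ))) =
      fun ω => A.indicator (fun _ => (1:ℝ)) ω + B.indicator (fun _ => (1:ℝ)) ω := rfl
    rw [e0, hrep _ _ (hadd _ _ (bddRV_ind mA) (bddRV_ind mB)) hW', hrep _ _ (bddRV_ind mA) hW',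
      hrep _ _ (bddRV_ind mB) hW', ind1 A mA, ind1 B mB, chq_ind hc mA mB,
      nuW_eq hG (ver hf₁), nuW_eq hG hk, nuW_eq hG vI, nuW_eq hG vU] at hs
    linarith
  · intro hcA W hW
    have hG := hGmono W hW
    have hc := nuW_capac hW hG
    refine ⟨fun X Y hX hY hXY => ?_, fun X c hX => ?_, fun X l hX hl => ?_, fun X Y hX hY => ?_⟩
    · rw [hrep X W hX hW, hrep Y W hY hW]
      refine chq_mono hc hX hY fun x => ?_
      apply nuW_mono hW hG (measurableSet_lt measurable_const hX.1)
        (measurableSet_lt measurable_const hY.1)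
      filter_upwards [hXY] with ω h1 h2
      exact lt_of_lt_of_le h2 h1
    · have hXc : BddRV (fun ω => X ω + c) :=
        hadd X (fun _ => c) hX ⟨measurable_const, |c|, fun _ => le_rfl⟩
      rw [hrep X W hX hW, hrep _ W hXc hW, chq_add_const hc hX]
    · have hXl : BddRV (fun ω => l * X ω) := by
        obtain ⟨hm, C, hC⟩ := hX
        exact ⟨hm.const_mul l, |l| * C, fun ω => by rw [abs_mul]; gcongr; exact hC ω⟩
      rw [hrep X W hX hW, hrep _ W hXl hW, chq_mul hc hX l hl]
    · have e0 : X + Y = fun ω => X ω + Y ω := rfl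
      rw [e0, hrep _ W (hadd X Y hX hY) hW, hrep X W hX hW, hrep Y W hY hW]
      exact chq_sub hc (nuW_submod hW hG (hcA W hW)) hX hY
end
end

section
/- Let {D_W : W ∈ 𝒴} be a family of increasing subsets of D* and let q_{D_W}(X, W) = inf{ x ∈ ℝ : F_{X|W=·}(x) ∈_{ℙ∘W⁻¹} D_W } be the associated quantile factor risk measure. Then q_{D_W} is law-invariant (q_{D_W}(X, W) = q_{D_{W'}}(X', W') whenever (X, W) and (X', W') are equal in joint distribution) if and only if {D_W : W ∈ 𝒴} is weakly law-invariant, i.e., for all A, A' ∈ 𝓕 and W, W' ∈ 𝒴 with (1_A, W) equal in joint distribution to (1_{A'}, W'), either ℙ(A | W = ·) ∈_{ℙ∘W⁻¹} D_W ∩ D_{W'} or ℙ(A | W = ·) ∉_{ℙ∘W⁻¹} D_W ∪ D_{W'}. -/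
open MeasureTheory ProbabilityTheory Set Filter

noncomputable section

/-- An increasing subset `D ⊆ D*`. -/
def IncreasingSubset {N : ℕ} (D : Set ((Fin N → ℝ) → ℝ)) : Prop :=
  (∀ f ∈ D, InDstar f) ∧ ((fun _ => (1:ℝ)) ∈ D) ∧ ((fun _ => (0:ℝ)) ∉ D) ∧
  ∀ f ∈ D, ∀ g : (Fin N → ℝ) → ℝ, InDstar g → (∀ w, f w ≤ g w) → g ∈ D

/-- `f ∈_μ D` : `f` agrees `μ`-a.e. with some member of `D`. -/
def InMu {N : ℕ} (μ : Measure (Fin N → ℝ)) (f : (Fin N → ℝ) → ℝ)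
    (D : Set ((Fin N → ℝ) → ℝ)) : Prop :=
  ∃ g ∈ D, ∀ᵐ w ∂μ, f w = g w

/-- `f` is a Borel measurable version of the conditional probability `P(A | W = ·)`. -/
def IsCondProb {Ω : Type*} [MeasurableSpace Ω] {N : ℕ} (P : Measure Ω)
    (A : Set Ω) (W : Ω → (Fin N → ℝ)) (f : (Fin N → ℝ) → ℝ) : Prop :=
  InDstar f ∧ ∀ S : Set (Fin N → ℝ), MeasurableSet S →
    (P (A ∩ W ⁻¹' S)).toReal = ∫ w in S, f w ∂(P.map W)

theorem aux_unique {Ω : Type*} [MeasurableSpace Ω] (P : Measure Ω) [IsProbabilityMeasure P]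
    {N : ℕ} {A : Set Ω} {W : Ω → (Fin N → ℝ)} (hW : Measurable W) {f g : (Fin N → ℝ) → ℝ}
    (hf : IsCondProb P A W f) (hg : IsCondProb P A W g) : f =ᵐ[P.map W] g := by
  haveI : IsProbabilityMeasure (P.map W) := Measure.isProbabilityMeasure_map hW.aemeasurable
  have hint : ∀ h : (Fin N → ℝ) → ℝ, InDstar h → Integrable h (P.map W) := by
    intro h hh
    refine Integrable.of_bound hh.1.aestronglyMeasurable 1 (Eventually.of_forall fun w => ?_)
    rw [Real.norm_eq_abs, abs_le]
    have := hh.2 w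
    exact ⟨by linarith [this.1], this.2⟩
  refine Integrable.ae_eq_of_forall_setIntegral_eq f g (hint f hf.1) (hint g hg.1) ?_
  intro S hS _
  rw [← hf.2 S hS, ← hg.2 S hS]

theorem aux_congr {N : ℕ} {μ : Measure (Fin N → ℝ)} {f g : (Fin N → ℝ) → ℝ}
    {D : Set ((Fin N → ℝ) → ℝ)} (h : f =ᵐ[μ] g) (hf : InMu μ f D) : InMu μ g D := by
  obtain ⟨k, hk, hfk⟩ := hf
  refine ⟨k, hk, ?_⟩
  filter_upwards [h, hfk] with w h1 h2
  rw [← h1, h2]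

theorem aux_max {N : ℕ} {f g : (Fin N → ℝ) → ℝ} (hf : InDstar f) (hg : InDstar g) :
    InDstar (fun w => max (f w) (g w)) :=
  ⟨hf.1.max hg.1, fun w => ⟨le_max_of_le_left (hf.2 w).1, max_le (hf.2 w).2 (hg.2 w).2⟩⟩

theorem aux_mono {N : ℕ} {μ : Measure (Fin N → ℝ)} {f g : (Fin N → ℝ) → ℝ}
    {D : Set ((Fin N → ℝ) → ℝ)} (hD : IncreasingSubset D) (hg : InDstar g)
    (hfg : ∀ w, f w ≤ g w) (hf : InMu μ f D) : InMu μ g D := by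
  obtain ⟨k, hk, hfk⟩ := hf
  refine ⟨fun w => max (k w) (g w),
    hD.2.2.2 k hk _ (aux_max (hD.1 k hk) hg) (fun w => le_max_left _ _), ?_⟩
  filter_upwards [hfk] with w h
  rw [← h, max_eq_right (hfg w)]

theorem aux_inter {N : ℕ} {μ : Measure (Fin N → ℝ)} {f : (Fin N → ℝ) → ℝ}
    {D D' : Set ((Fin N → ℝ) → ℝ)} (hD : IncreasingSubset D) (hD' : IncreasingSubset D')
    (hf : InMu μ f D) (hf' : InMu μ f D') : InMu μ f (D ∩ D') := by
  obtain ⟨k, hk, hfk⟩ := hf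
  obtain ⟨k', hk', hfk'⟩ := hf'
  have hm := aux_max (hD.1 k hk) (hD'.1 k' hk')
  refine ⟨fun w => max (k w) (k' w),
    ⟨hD.2.2.2 k hk _ hm (fun w => le_max_left _ _),
      hD'.2.2.2 k' hk' _ hm (fun w => le_max_right _ _)⟩, ?_⟩
  filter_upwards [hfk, hfk'] with w h h'
  rw [← h, ← h', max_self]

theorem aux_cdf {Ω : Type*} [MeasurableSpace Ω] (P : Measure Ω) [IsProbabilityMeasure P]
    {N : ℕ} {X : Ω → ℝ} {W : Ω → (Fin N → ℝ)}
    {K : Kernel (Fin N → ℝ) ℝ} (hK : IsCondDistrib P X W K) (x : ℝ) :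
    IsCondProb P {ω | X ω ≤ x} W (fun w => (K w (Iic x)).toReal) := by
  haveI := hK.1
  have hm : Measurable fun w => K w (Iic x) := K.measurable_coe measurableSet_Iic
  refine ⟨⟨hm.ennreal_toReal, fun w => ⟨ENNReal.toReal_nonneg, ?_⟩⟩, ?_⟩
  · exact ENNReal.toReal_le_of_le_ofReal zero_le_one (by simpa using prob_le_one)
  · intro S hS
    rw [integral_toReal hm.aemeasurable (Eventually.of_forall fun w => measure_lt_top _ _),
      ← hK.2 _ measurableSet_Iic S hS]
    rfl

theorem aux_law {Ω : Type*} [MeasurableSpace Ω] (P : Measure Ω)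
    {N : ℕ} {X X' : Ω → ℝ} {W W' : Ω → (Fin N → ℝ)} (hX : Measurable X) (hX' : Measurable X')
    (hW : Measurable W) (hW' : Measurable W')
    (h : (P.map fun ω => (X ω, W ω)) = (P.map fun ω => (X' ω, W' ω))) :
    P.map W = P.map W' := by
  have := congrArg (Measure.map Prod.snd) h
  rwa [Measure.map_map measurable_snd (hX.prodMk hW),
    Measure.map_map measurable_snd (hX'.prodMk hW')] at this

theorem aux_comp {Ω : Type*} [MeasurableSpace Ω] (P : Measure Ω)
    {N : ℕ} {X X' : Ω → ℝ} {W W' : Ω → (Fin N → ℝ)} (hX : Measurable X) (hX' : Measurable X')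
    (hW : Measurable W) (hW' : Measurable W')
    (h : (P.map fun ω => (X ω, W ω)) = (P.map fun ω => (X' ω, W' ω)))
    (φ : ℝ → ℝ) (hφ : Measurable φ) :
    (P.map fun ω => (φ (X ω), W ω)) = (P.map fun ω => (φ (X' ω), W' ω)) := by
  have hm : Measurable fun p : ℝ × (Fin N → ℝ) => (φ p.1, p.2) :=
    (hφ.comp measurable_fst).prodMk measurable_snd
  have := congrArg (Measure.map (fun p : ℝ × (Fin N → ℝ) => (φ p.1, p.2))) h
  rwa [Measure.map_map hm (hX.prodMk hW), Measure.map_map hm (hX'.prodMk hW')] at this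

theorem aux_transfer {Ω : Type*} [MeasurableSpace Ω] (P : Measure Ω)
    {N : ℕ} {A A' : Set Ω} {W W' : Ω → (Fin N → ℝ)}
    (hA : MeasurableSet A) (hA' : MeasurableSet A')
    (hW : Measurable W) (hW' : Measurable W')
    (h : (P.map fun ω => (A.indicator (fun _ => (1:ℝ)) ω, W ω)) =
        (P.map fun ω => (A'.indicator (fun _ => (1:ℝ)) ω, W' ω)))
    {f : (Fin N → ℝ) → ℝ} (hf : IsCondProb P A W f) : IsCondProb P A' W' f := by
  have hX : Measurable (A.indicator (fun _ => (1:ℝ))) := measurable_const.indicator hA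
  have hX' : Measurable (A'.indicator (fun _ => (1:ℝ))) := measurable_const.indicator hA'
  refine ⟨hf.1, fun S hS => ?_⟩
  rw [← aux_law P hX hX' hW hW' h, ← hf.2 S hS]
  have h1 := congrArg (fun m => m ({(1:ℝ)} ×ˢ S)) h
  have hms : MeasurableSet ({(1:ℝ)} ×ˢ S) := (measurableSet_singleton _).prod hS
  simp only [Measure.map_apply (hX.prodMk hW) hms, Measure.map_apply (hX'.prodMk hW') hms] at h1
  have e : ∀ (B : Set Ω) (V : Ω → (Fin N → ℝ)),
      (fun ω => (B.indicator (fun _ => (1:ℝ)) ω, V ω)) ⁻¹' ({(1:ℝ)} ×ˢ S) = B ∩ V ⁻¹' S := by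
    intro B V
    ext ω
    by_cases hω : ω ∈ B <;> simp [hω]
  rw [e, e] at h1
  rw [h1]

theorem aux_exists {Ω : Type*} [MeasurableSpace Ω] (P : Measure Ω) [IsProbabilityMeasure P]
    {N : ℕ} {X : Ω → ℝ} {W : Ω → (Fin N → ℝ)} (hX : Measurable X) (hW : Measurable W) :
    ∃ K : Kernel (Fin N → ℝ) ℝ, IsCondDistrib P X W K := by
  refine ⟨condDistrib X W P, inferInstance, fun B hB S hS => ?_⟩
  haveI : IsProbabilityMeasure (P.map W) := Measure.isProbabilityMeasure_map hW.aemeasurable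
  have h := compProd_map_condDistrib (mβ := inferInstance) (μ := P) (X := W) (Y := X) hX.aemeasurable
  have h1 := congrArg (fun m => m (S ×ˢ B)) h
  simp only [Measure.compProd_apply_prod hS hB,
    Measure.map_apply (hW.prodMk hX) (hS.prod hB)] at h1
  rw [h1]
  congr 1
  ext ω
  simp [and_comm]

theorem aux_quant {Ω : Type*} [MeasurableSpace Ω] (P : Measure Ω) [IsProbabilityMeasure P]
    {N : ℕ} {A : Set Ω} {W : Ω → (Fin N → ℝ)} (hW : Measurable W)
    {D : Set ((Fin N → ℝ) → ℝ)} (hD : IncreasingSubset D) {f : (Fin N → ℝ) → ℝ}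
    (hf : IsCondProb P A W f) {K : Kernel (Fin N → ℝ) ℝ}
    (hK : IsCondDistrib P (fun ω => 2 - A.indicator (fun _ => (1:ℝ)) ω) W K) :
    InMu (P.map W) f D ↔
      sInf {x : ℝ | InMu (P.map W) (fun w => (K w (Iic x)).toReal) D} ≤ 1 := by
  haveI := hK.1
  have hlow : ∀ x : ℝ, 1 ≤ x → x < 2 → (fun w => (K w (Iic x)).toReal) =ᵐ[P.map W] f := by
    intro x hx1 hx2
    refine aux_unique P hW (aux_cdf P hK x) ?_
    have : {ω | 2 - A.indicator (fun _ => (1:ℝ)) ω ≤ x} = A := by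
      ext ω
      by_cases hω : ω ∈ A
      · simp [hω]; linarith
      · simp [hω]; linarith
    rwa [this]
  constructor
  · intro h
    have h1 : (1:ℝ) ∈ {x : ℝ | InMu (P.map W) (fun w => (K w (Iic x)).toReal) D} :=
      aux_congr (hlow 1 le_rfl (by norm_num)).symm h
    by_cases hb : BddBelow {x : ℝ | InMu (P.map W) (fun w => (K w (Iic x)).toReal) D}
    · exact csInf_le hb h1
    · rw [Real.sInf_of_not_bddBelow hb]; exact zero_le_one
  · intro h
    by_contra hn
    have hne : (2:ℝ) ∈ {x : ℝ | InMu (P.map W) (fun w => (K w (Iic x)).toReal) D} := by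
      refine aux_congr (f := fun _ => (1:ℝ)) ?_ ⟨_, hD.2.1, Eventually.of_forall fun _ => rfl⟩
      refine aux_unique P hW (A := univ) ?_ ?_
      · refine ⟨⟨measurable_const, fun w => by simp⟩, fun S hS => ?_⟩
        simp [Measure.real, Measure.map_apply hW hS]
      · have := aux_cdf P hK 2
        have e : {ω | 2 - A.indicator (fun _ => (1:ℝ)) ω ≤ 2} = univ := by
          ext ω
          by_cases hω : ω ∈ A <;> simp [hω]
        rwa [e] at this
    have h2 : (2:ℝ) ≤ sInf {x : ℝ | InMu (P.map W) (fun w => (K w (Iic x)).toReal) D} := by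
      refine le_csInf ⟨2, hne⟩ fun x hx => ?_
      by_contra hx2
      push Not at hx2
      apply hn
      have hy1 : (1:ℝ) ≤ max x 1 := le_max_right _ _
      have hy2 : max x 1 < 2 := max_lt hx2 (by norm_num)
      refine aux_congr (hlow (max x 1) hy1 hy2) ?_
      refine aux_mono hD (aux_cdf P hK (max x 1)).1 (fun w => ?_) hx
      exact ENNReal.toReal_mono (measure_ne_top _ _)
        (measure_mono (Iic_subset_Iic.2 (le_max_left _ _)))
    linarith

/-- **Proposition (weak law-invariance characterizes law-invariance of quantile factor
risk measures).** -/
theorem stmt9 {Ω : Type*} [MeasurableSpace Ω] (P : Measure Ω) [IsProbabilityMeasure P]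
    (hatomless : Atomless P) {N : ℕ} (hN : 1 ≤ N)
    (D : (Ω → (Fin N → ℝ)) → Set ((Fin N → ℝ) → ℝ))
    (hD : ∀ W : Ω → (Fin N → ℝ), Measurable W → IncreasingSubset (D W)) :
    -- law-invariance of `q_{D_W}`
    (∀ (X X' : Ω → ℝ) (W W' : Ω → (Fin N → ℝ)),
      BddRV X → BddRV X' → Measurable W → Measurable W' →
      (P.map fun ω => (X ω, W ω)) = (P.map fun ω => (X' ω, W' ω)) →
      ∀ K K' : Kernel (Fin N → ℝ) ℝ, IsCondDistrib P X W K → IsCondDistrib P X' W' K' →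
        sInf {x : ℝ | InMu (P.map W) (fun w => (K w (Iic x)).toReal) (D W)} =
          sInf {x : ℝ | InMu (P.map W') (fun w => (K' w (Iic x)).toReal) (D W')})
    ↔
    -- weak law-invariance of `{D_W}`
    (∀ (A A' : Set Ω) (W W' : Ω → (Fin N → ℝ)),
      MeasurableSet A → MeasurableSet A' → Measurable W → Measurable W' →
      (P.map fun ω => (A.indicator (fun _ => (1:ℝ)) ω, W ω)) =
        (P.map fun ω => (A'.indicator (fun _ => (1:ℝ)) ω, W' ω)) →
      ∀ f : (Fin N → ℝ) → ℝ, IsCondProb P A W f →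
        (InMu (P.map W) f (D W ∩ D W') ∨ ¬ InMu (P.map W) f (D W ∪ D W'))) := by
  constructor
  · intro hq A A' W W' hA hA' hW hW' hlaw f hf
    have hI : Measurable (A.indicator (fun _ => (1:ℝ))) := measurable_const.indicator hA
    have hI' : Measurable (A'.indicator (fun _ => (1:ℝ))) := measurable_const.indicator hA'
    have hf' := aux_transfer P hA hA' hW hW' hlaw hf
    have hμ := aux_law P hI hI' hW hW' hlaw
    have hX : Measurable (fun ω => 2 - A.indicator (fun _ => (1:ℝ)) ω) := hI.const_sub 2
    have hX' : Measurable (fun ω => 2 - A'.indicator (fun _ => (1:ℝ)) ω) := hI'.const_sub 2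
    obtain ⟨K, hK⟩ := aux_exists P hX hW
    obtain ⟨K', hK'⟩ := aux_exists P hX' hW'
    have hb : ∀ B : Set Ω, ∃ C : ℝ, ∀ ω, |2 - B.indicator (fun _ => (1:ℝ)) ω| ≤ C := by
      intro B
      refine ⟨2, fun ω => ?_⟩
      by_cases hω : ω ∈ B
      · simp only [indicator_of_mem hω]; norm_num
      · simp only [indicator_of_notMem hω]; norm_num
    have heq := hq _ _ W W' ⟨hX, hb A⟩ ⟨hX', hb A'⟩ hW hW'
      (aux_comp P hI hI' hW hW' hlaw (fun x => 2 - x) (measurable_id.const_sub 2)) K K' hK hK'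
    have h1 := aux_quant P hW (hD W hW) hf hK
    have h2 := aux_quant P hW' (hD W' hW') hf' hK'
    rw [heq, ← h2, ← hμ] at h1
    by_cases h : InMu (P.map W) f (D W)
    · exact Or.inl (aux_inter (hD W hW) (hD W' hW') h (h1.1 h))
    · right
      rintro ⟨g, hg | hg, hfg⟩
      · exact h ⟨g, hg, hfg⟩
      · exact h (h1.2 ⟨g, hg, hfg⟩)
  · intro hw X X' W W' hX hX' hW hW' hlaw K K' hK hK'
    have hμ := aux_law P hX.1 hX'.1 hW hW' hlaw
    congr 1
    ext x
    simp only [mem_setOf_eq]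
    have hA : MeasurableSet {ω | X ω ≤ x} := hX.1 measurableSet_Iic
    have hA' : MeasurableSet {ω | X' ω ≤ x} := hX'.1 measurableSet_Iic
    have hlaw' := aux_comp P hX.1 hX'.1 hW hW' hlaw ((Iic x).indicator fun _ => (1:ℝ))
      (measurable_const.indicator measurableSet_Iic)
    have hf := aux_cdf P hK x
    have hf' := aux_transfer P hA hA' hW hW' hlaw' hf
    have hae := aux_unique P hW' hf' (aux_cdf P hK' x)
    have key := hw _ _ W W' hA hA' hW hW' hlaw' _ hf
    rw [← hμ] at hae ⊢
    have hiff : InMu (P.map W) (fun w => (K w (Iic x)).toReal) (D W) ↔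
        InMu (P.map W) (fun w => (K w (Iic x)).toReal) (D W') := by
      rcases key with ⟨g, hg, hfg⟩ | hn
      · exact ⟨fun _ => ⟨g, hg.2, hfg⟩, fun _ => ⟨g, hg.1, hfg⟩⟩
      · constructor
        · rintro ⟨g, hg, hfg⟩; exact absurd ⟨g, Or.inl hg, hfg⟩ hn
        · rintro ⟨g, hg, hfg⟩; exact absurd ⟨g, Or.inr hg, hfg⟩ hn
    rw [hiff]
    exact ⟨aux_congr hae, aux_congr hae.symm⟩
end
end

section
/- Let 𝒴_D be the set of all discrete Borel-measurable random vectors W : Ω → ℝ^N, and for W ∈ 𝒴_D set S¹_W = {w ∈ ℝ^N : ℙ(W = w) > 0}. A mapping ρ : 𝒳 × 𝒴_D → ℝ satisfies conditions M, OR and LI if and only if there exists a law-invariant family of increasing sets {D¹_W : W ∈ 𝒴_D}, D¹_W ⊊ [0,1]^{S¹_W}, such that ρ(X, W) = inf{ x ∈ ℝ : (F_{X|W=w}(x))_{w ∈ S¹_W} ∈ D¹_W } for all X ∈ 𝒳 and W ∈ 𝒴_D. -/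
open MeasureTheory ProbabilityTheory Set Filter

noncomputable section

/-- `S¹_W`: the atoms of a discrete random vector `W`. -/
def S1 {Ω : Type*} [MeasurableSpace Ω] {N : ℕ} (P : Measure Ω)
    (W : Ω → (Fin N → ℝ)) : Set (Fin N → ℝ) :=
  {w | 0 < P (W ⁻¹' {w})}

/-- An increasing set of `[0,1]`-valued families indexed by `S¹_W` (modelled as total
functions, compared only on `S¹_W`). -/
def IncreasingSetOn1 {N : ℕ} (S : Set (Fin N → ℝ)) (D : Set ((Fin N → ℝ) → ℝ)) : Prop :=
  (∀ f ∈ D, ∀ w ∈ S, f w ∈ Icc (0:ℝ) 1) ∧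
  ((fun _ => (1:ℝ)) ∈ D) ∧ ((fun _ => (0:ℝ)) ∉ D) ∧
  ∀ g : (Fin N → ℝ) → ℝ, (∀ w ∈ S, g w ∈ Icc (0:ℝ) 1) →
    (∃ f ∈ D, ∀ w ∈ S, f w ≤ g w) → g ∈ D

lemma aux_small {Ω : Type*} [MeasurableSpace Ω] (P : Measure Ω) [IsProbabilityMeasure P]
    (h : Atomless P) (A : Set Ω) (hA : MeasurableSet A) (hpos : 0 < P.real A) (ε : ℝ) (hε : 0 < ε) :
    ∃ C, C ⊆ A ∧ MeasurableSet C ∧ 0 < P.real C ∧ P.real C < ε := by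
  have key : ∀ n : ℕ, ∃ C, C ⊆ A ∧ MeasurableSet C ∧ 0 < P.real C ∧
      P.real C ≤ P.real A * (1/2)^n := by
    intro n
    induction n with
    | zero => exact ⟨A, subset_rfl, hA, hpos, by simp⟩
    | succ n ih =>
      obtain ⟨C, hCA, hC, hC0, hCle⟩ := ih
      have hC0' : 0 < P C := by
        rw [measureReal_def, ENNReal.toReal_pos_iff] at hC0; exact hC0.1
      obtain ⟨B, hBC, hB, hB0, hBlt⟩ := h C hC hC0'
      have h1 : 0 < P.real B := ENNReal.toReal_pos hB0.ne' (measure_ne_top _ _)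
      have h2 : P.real B < P.real C :=
        (ENNReal.toReal_lt_toReal (measure_ne_top _ _) (measure_ne_top _ _)).2 hBlt
      have h3 : P.real (C \ B) = P.real C - P.real B := measureReal_diff hBC hB
      rw [pow_succ]
      by_cases hle : P.real B ≤ P.real C / 2
      · exact ⟨B, hBC.trans hCA, hB, h1, by linarith⟩
      · exact ⟨C \ B, diff_subset.trans hCA, hC.diff hB, by linarith, by linarith⟩
  obtain ⟨n, hn⟩ := exists_pow_lt_of_lt_one (div_pos hε hpos) (by norm_num : (1/2:ℝ) < 1)
  obtain ⟨C, h1, h2, h3, h4⟩ := key n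
  refine ⟨C, h1, h2, h3, h4.trans_lt ?_⟩
  rw [lt_div_iff₀ hpos] at hn
  linarith

lemma aux_sier {Ω : Type*} [MeasurableSpace Ω] (P : Measure Ω) [IsProbabilityMeasure P]
    (h : Atomless P) (A : Set Ω) (hA : MeasurableSet A) (c : ℝ) (hc0 : 0 ≤ c)
    (hc : c ≤ P.real A) :
    ∃ B, B ⊆ A ∧ MeasurableSet B ∧ P.real B = c := by
  let T := {B : Set Ω // MeasurableSet B ∧ B ⊆ A ∧ P.real B ≤ c}
  have step : ∀ B : T, ∃ B' : T, B.1 ⊆ B'.1 ∧ ∀ B'' : T, B.1 ⊆ B''.1 →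
      P.real B''.1 - P.real B.1 ≤ 2 * (P.real B'.1 - P.real B.1) := by
    intro B
    let V : Set ℝ := {r | ∃ B'' : T, B.1 ⊆ B''.1 ∧ P.real B''.1 = r}
    have hV : BddAbove V := ⟨c, by rintro r ⟨B'', _, rfl⟩; exact B''.2.2.2⟩
    have hB : P.real B.1 ∈ V := ⟨B, subset_rfl, rfl⟩
    rcases (le_csSup hV hB).eq_or_lt with he | hlt
    · refine ⟨B, subset_rfl, fun B'' hs => ?_⟩
      have := le_csSup hV ⟨B'', hs, rfl⟩
      linarith
    · obtain ⟨r, ⟨B', hs', rfl⟩, hr⟩ := exists_lt_of_lt_csSup ⟨_, hB⟩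
        (show (P.real B.1 + sSup V) / 2 < sSup V by linarith)
      refine ⟨B', hs', fun B'' hs => ?_⟩
      have := le_csSup hV ⟨B'', hs, rfl⟩
      linarith
  choose f hf1 hf2 using step
  let B0 : T := ⟨∅, MeasurableSet.empty, empty_subset _, by simpa using hc0⟩
  let s : ℕ → T := fun n => Nat.rec B0 (fun _ b => f b) n
  have hs : ∀ n, s (n+1) = f (s n) := fun n => rfl
  have hmono : Monotone (fun n => (s n).1) :=
    monotone_nat_of_le_succ fun n => by rw [hs]; exact hf1 _
  let U := ⋃ n, (s n).1
  have hU : MeasurableSet U := MeasurableSet.iUnion fun n => (s n).2.1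
  have hUA : U ⊆ A := iUnion_subset fun n => (s n).2.2.1
  have hlim : Tendsto (fun n => P.real (s n).1) atTop (nhds (P.real U)) :=
    (ENNReal.tendsto_toReal (measure_ne_top _ _)).comp (tendsto_measure_iUnion_atTop hmono)
  have hUc : P.real U ≤ c := le_of_tendsto' hlim fun n => (s n).2.2.2
  refine ⟨U, hUA, hU, hUc.antisymm ?_⟩
  by_contra! hlt
  have hd : P.real (A \ U) = P.real A - P.real U := measureReal_diff hUA hU
  obtain ⟨C, hC1, hC2, hC3, hC4⟩ := aux_small P h (A \ U) (hA.diff hU) (by linarith)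
    (c - P.real U) (by linarith)
  have hle : ∀ n, P.real C ≤ 2 * (P.real (s (n+1)).1 - P.real (s n).1) := by
    intro n
    have hsub : (s n).1 ⊆ U := subset_iUnion (fun n => (s n).1) n
    have hdis : Disjoint (s n).1 C :=
      (disjoint_sdiff_right (s := U) (t := A)).mono hsub hC1
    have hu : P.real ((s n).1 ∪ C) = P.real (s n).1 + P.real C :=
      measureReal_union hdis hC2
    have hm : P.real (s n).1 ≤ P.real U := measureReal_mono hsub
    have := hf2 (s n) ⟨(s n).1 ∪ C, (s n).2.1.union hC2,
      union_subset (s n).2.2.1 (hC1.trans diff_subset), by linarith⟩ subset_union_left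
    rw [hs]
    simp only [hu] at this
    linarith
  have hlim2 := ((hlim.comp (tendsto_add_atTop_nat 1)).sub hlim).const_mul 2
  have := ge_of_tendsto' hlim2 hle
  linarith

lemma aux_cnt {Ω α : Type*} [MeasurableSpace Ω] [MeasurableSpace α] [MeasurableSingletonClass α]
    (P : Measure Ω) (W : Ω → α) (hW : Measurable W) (R : Set α) (hR : R.Countable)
    (hWR : range W ⊆ R) (B : Set Ω) (hB : MeasurableSet B) (U : Set α) :
    P (B ∩ W ⁻¹' U) = ∑' w : ↥(R ∩ U), P (B ∩ W ⁻¹' {w.1}) := by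
  have : B ∩ W ⁻¹' U = ⋃ w ∈ R ∩ U, (B ∩ W ⁻¹' {w}) := by
    ext ω
    simp only [mem_inter_iff, mem_preimage, mem_iUnion, mem_singleton_iff, exists_prop]
    constructor
    · rintro ⟨h1, h2⟩
      exact ⟨W ω, ⟨hWR ⟨ω, rfl⟩, h2⟩, h1, rfl⟩
    · rintro ⟨w, ⟨_, h2⟩, h1, rfl⟩
      exact ⟨h1, h2⟩
  rw [this, measure_biUnion (hR.mono inter_subset_left)]
  · intro a _ b _ hab
    refine Set.disjoint_left.2 ?_
    rintro ω ⟨_, h1⟩ ⟨_, h2⟩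
    exact hab (h1.symm.trans h2)
  · intro b _
    exact hB.inter (hW (measurableSet_singleton b))

lemma aux_null {Ω α : Type*} [MeasurableSpace Ω] [MeasurableSpace α] [MeasurableSingletonClass α]
    (P : Measure Ω) (W : Ω → α) (hW : Measurable W) (hR : (range W).Countable)
    (B : Set Ω) (hB : MeasurableSet B) (h : ∀ w, P (B ∩ W ⁻¹' {w}) = 0) : P B = 0 := by
  have := aux_cnt P W hW _ hR subset_rfl B hB univ
  simpa [h] using this

lemma aux_joint {Ω α : Type*} [MeasurableSpace Ω] [MeasurableSpace α] [MeasurableSingletonClass α]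
    (P : Measure Ω) [IsProbabilityMeasure P] (W W' : Ω → α) (hW : Measurable W)
    (hW' : Measurable W') (hR : (range W).Countable) (hR' : (range W').Countable)
    (hmap : P.map W = P.map W')
    (B B' : Set Ω) (hB : MeasurableSet B) (hB' : MeasurableSet B')
    (h : ∀ w, P (B ∩ W ⁻¹' {w}) = P (B' ∩ W' ⁻¹' {w})) :
    (P.map fun ω => (Bᶜ.indicator (fun _ => (1:ℝ)) ω, W ω)) =
      (P.map fun ω => (B'ᶜ.indicator (fun _ => (1:ℝ)) ω, W' ω)) := by
  have hRR := hR.union hR'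
  have h1 : ∀ U : Set α, P (B ∩ W ⁻¹' U) = P (B' ∩ W' ⁻¹' U) := by
    intro U
    rw [aux_cnt P W hW _ hRR subset_union_left B hB U,
      aux_cnt P W' hW' _ hRR subset_union_right B' hB' U]
    simp only [h]
  have h2 : ∀ U : Set α, MeasurableSet U → P (Bᶜ ∩ W ⁻¹' U) = P (B'ᶜ ∩ W' ⁻¹' U) := by
    intro U hU
    have e : P (W ⁻¹' U) = P (W' ⁻¹' U) := by
      rw [← Measure.map_apply hW hU, ← Measure.map_apply hW' hU, hmap]
    have a1 := measure_inter_add_diff (μ := P) (W ⁻¹' U) hB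
    have a2 := measure_inter_add_diff (μ := P) (W' ⁻¹' U) hB'
    rw [e, ← a2, inter_comm, h1 U, inter_comm] at a1
    have := (ENNReal.add_right_inj (measure_ne_top P _)).1 a1
    rwa [diff_eq, diff_eq, inter_comm, inter_comm (W' ⁻¹' U)] at this
  have form : ∀ (C : Set Ω) (V : Ω → α), MeasurableSet C → Measurable V → ∀ T,
      MeasurableSet T →
      (P.map fun ω => (Cᶜ.indicator (fun _ => (1:ℝ)) ω, V ω)) T =
        P (C ∩ V ⁻¹' {w | ((0:ℝ), w) ∈ T}) + P (Cᶜ ∩ V ⁻¹' {w | ((1:ℝ), w) ∈ T}) := by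
    intro C V hC hV T hT
    rw [Measure.map_apply ((measurable_const.indicator hC.compl).prodMk hV) hT,
      ← measure_inter_add_diff _ hC]
    congr 2
    · ext ω
      by_cases hω : ω ∈ C <;> simp [hω]
    · ext ω
      by_cases hω : ω ∈ C <;> simp [hω]
  ext T hT
  rw [form B W hB hW T hT, form B' W' hB' hW' T hT, h1, h2]
  exact measurable_prodMk_left hT

lemma aux_transfer_s10 {Ω α : Type*} [MeasurableSpace Ω] [MeasurableSpace α]
    [MeasurableSingletonClass α]
    (P : Measure Ω) [IsProbabilityMeasure P] (hat : Atomless P) (W W' : Ω → α)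
    (hW : Measurable W) (hR : (range W).Countable)
    (A B : Set Ω) (hA : MeasurableSet A)
    (h : ∀ w, P.real (B ∩ W' ⁻¹' {w}) ≤ P.real (A ∩ W ⁻¹' {w})) :
    ∃ B', B' ⊆ A ∧ MeasurableSet B' ∧ ∀ w, P (B' ∩ W ⁻¹' {w}) = P (B ∩ W' ⁻¹' {w}) := by
  have := fun w => aux_sier P hat (A ∩ W ⁻¹' {w}) (hA.inter (hW (measurableSet_singleton w)))
    _ measureReal_nonneg (h w)
  choose G hG1 hG2 hG3 using this
  refine ⟨⋃ w ∈ range W, G w, iUnion₂_subset fun w _ => (hG1 w).trans inter_subset_left,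
    MeasurableSet.biUnion hR fun w _ => hG2 w, fun w => ?_⟩
  have : (⋃ w ∈ range W, G w) ∩ W ⁻¹' {w} = G w := by
    ext ω
    simp only [mem_inter_iff, mem_iUnion, mem_preimage, mem_singleton_iff, exists_prop]
    constructor
    · rintro ⟨⟨v, _, hv⟩, rfl⟩
      have : W ω = v := (hG1 v hv).2
      rwa [this]
    · intro hω
      have : W ω = w := (hG1 w hω).2
      exact ⟨⟨w, ⟨ω, this⟩, hω⟩, this⟩
  rw [this]
  exact (ENNReal.toReal_eq_toReal_iff' (measure_ne_top _ _) (measure_ne_top _ _)).1 (hG3 w)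

lemma aux_bdd_ind {Ω : Type*} [MeasurableSpace Ω] (A : Set Ω) (hA : MeasurableSet A) :
    BddRV (A.indicator (fun _ => (1:ℝ))) := by
  refine ⟨measurable_const.indicator hA, 1, fun ω => ?_⟩
  by_cases h : ω ∈ A <;> simp [h]

lemma aux_bdd_comp {Ω : Type*} [MeasurableSpace Ω] {X : Ω → ℝ} (hX : BddRV X) (φ : ℝ → ℝ)
    (hc : Continuous φ) (hm : StrictMono φ) : BddRV (fun ω => φ (X ω)) := by
  obtain ⟨h1, C, hC⟩ := hX
  refine ⟨hc.measurable.comp h1, max |φ C| |φ (-C)|, fun ω => ?_⟩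
  have h2 := hm.monotone (abs_le.1 (hC ω)).1
  have h3 := hm.monotone (abs_le.1 (hC ω)).2
  rw [abs_le]
  constructor
  · have := neg_abs_le (φ (-C)); have := le_max_right |φ C| |φ (-C)|; linarith
  · have := le_abs_self (φ C); have := le_max_left |φ C| |φ (-C)|; linarith

lemma aux_cond {Ω : Type*} [MeasurableSpace Ω] {N : ℕ} (P : Measure Ω)
    (W : Ω → (Fin N → ℝ)) (hW : Measurable W) (w : Fin N → ℝ) (E : Set Ω) :
    ((P[|W ⁻¹' {w}]) E).toReal = (P.real (W ⁻¹' {w}))⁻¹ * P.real (E ∩ W ⁻¹' {w}) := by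
  rw [cond_apply (hW (measurableSet_singleton w)), ENNReal.toReal_mul, ENNReal.toReal_inv,
    inter_comm]
  rfl

lemma aux_cond_mem {Ω : Type*} [MeasurableSpace Ω] {N : ℕ} (P : Measure Ω)
    [IsProbabilityMeasure P]
    (W : Ω → (Fin N → ℝ)) (hW : Measurable W) (w : Fin N → ℝ) (E : Set Ω) :
    ((P[|W ⁻¹' {w}]) E).toReal ∈ Icc (0:ℝ) 1 := by
  refine ⟨ENNReal.toReal_nonneg, ?_⟩
  rw [aux_cond P W hW]
  have : P.real (E ∩ W ⁻¹' {w}) ≤ P.real (W ⁻¹' {w}) := measureReal_mono inter_subset_right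
  exact inv_mul_le_one_of_le₀ this measureReal_nonneg

lemma aux_map_pre {Ω : Type*} [MeasurableSpace Ω] {N : ℕ} (P : Measure Ω)
    (W W' : Ω → (Fin N → ℝ)) (hW : Measurable W) (hW' : Measurable W')
    (h : P.map W = P.map W') (w : Fin N → ℝ) : P (W ⁻¹' {w}) = P (W' ⁻¹' {w}) := by
  rw [← Measure.map_apply hW (measurableSet_singleton w), h,
    Measure.map_apply hW' (measurableSet_singleton w)]

lemma aux_S1 {Ω : Type*} [MeasurableSpace Ω] {N : ℕ} (P : Measure Ω)
    (W W' : Ω → (Fin N → ℝ)) (hW : Measurable W) (hW' : Measurable W')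
    (h : P.map W = P.map W') : S1 P W = S1 P W' := by
  ext w
  simp only [S1, mem_setOf_eq, aux_map_pre P W W' hW hW' h]

lemma aux_A {Ω : Type*} [MeasurableSpace Ω] {N : ℕ} (P : Measure Ω) [IsProbabilityMeasure P]
    (W : Ω → (Fin N → ℝ)) (D : Set ((Fin N → ℝ) → ℝ))
    (hD : IncreasingSetOn1 (S1 P W) D) (X : Ω → ℝ) (C : ℝ) :
    ((∀ ω, X ω ≤ C) → (fun w => ((P[|W ⁻¹' {w}]) {ω | X ω ≤ C}).toReal) ∈ D) ∧
    ((∀ ω, C < X ω) → (fun w => ((P[|W ⁻¹' {w}]) {ω | X ω ≤ C}).toReal) ∉ D) := by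
  obtain ⟨_, d1, d0, dm⟩ := hD
  constructor
  · intro h
    have hu : {ω | X ω ≤ C} = univ := by ext ω; simp [h]
    have h1 : ∀ w ∈ S1 P W, ((P[|W ⁻¹' {w}]) {ω | X ω ≤ C}).toReal = 1 := by
      intro w hw
      have := cond_isProbabilityMeasure (μ := P) (s := W ⁻¹' {w}) (ne_of_gt hw)
      rw [hu]; simp
    exact dm _ (fun w hw => by rw [h1 w hw]; simp) ⟨_, d1, fun w hw => by rw [h1 w hw]⟩
  · intro h hmem
    have hu : {ω | X ω ≤ C} = ∅ := by ext ω; simp [h]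
    refine d0 (dm _ (fun w hw => by simp) ⟨_, hmem, fun w hw => ?_⟩)
    simp [hu]

lemma aux_mono_s10 {Ω : Type*} [MeasurableSpace Ω] {N : ℕ} (P : Measure Ω) [IsProbabilityMeasure P]
    (W : Ω → (Fin N → ℝ)) (hW : Measurable W) (D : Set ((Fin N → ℝ) → ℝ))
    (hD : IncreasingSetOn1 (S1 P W) D) (E E' : Set Ω) (h : E ≤ᵐ[P] E')
    (hE : (fun w => ((P[|W ⁻¹' {w}]) E).toReal) ∈ D) :
    (fun w => ((P[|W ⁻¹' {w}]) E').toReal) ∈ D := by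
  refine hD.2.2.2 _ (fun w _ => aux_cond_mem P W hW w E') ⟨_, hE, fun w hw => ?_⟩
  have := cond_isProbabilityMeasure (μ := P) (s := W ⁻¹' {w}) (ne_of_gt hw)
  exact ENNReal.toReal_mono (measure_ne_top _ _)
    (measure_mono_ae (cond_absolutelyContinuous.ae_le h))

lemma aux_back {Ω : Type*} [MeasurableSpace Ω] (P : Measure Ω) [IsProbabilityMeasure P]
    {N : ℕ} (ρ : (Ω → ℝ) → (Ω → (Fin N → ℝ)) → ℝ)
    (D1 : (Ω → (Fin N → ℝ)) → Set ((Fin N → ℝ) → ℝ))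
    (hD : ∀ W : Ω → (Fin N → ℝ), Measurable W → (Set.range W).Countable →
        IncreasingSetOn1 (S1 P W) (D1 W))
    (hL : ∀ W W' : Ω → (Fin N → ℝ), Measurable W → Measurable W' →
        (Set.range W).Countable → (Set.range W').Countable →
        P.map W = P.map W' → D1 W = D1 W')
    (hρ : ∀ X W, BddRV X → Measurable W → (Set.range W).Countable →
        ρ X W = sInf {x : ℝ |
          (fun w => ((P[|W ⁻¹' {w}]) {ω | X ω ≤ x}).toReal) ∈ D1 W}) :
    ((∀ X Y W, BddRV X → BddRV Y → Measurable W → (Set.range W).Countable →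
        (∀ᵐ ω ∂P, X ω ≤ Y ω) → ρ X W ≤ ρ Y W) ∧
     (∀ (φ : ℝ → ℝ), Continuous φ → StrictMono φ →
        ∀ X W, BddRV X → Measurable W → (Set.range W).Countable →
          ρ (fun ω => φ (X ω)) W = φ (ρ X W)) ∧
     (∀ X X' W W', BddRV X → BddRV X' → Measurable W → Measurable W' →
        (Set.range W).Countable → (Set.range W').Countable →
        (P.map fun ω => (X ω, W ω)) = (P.map fun ω => (X' ω, W' ω)) → ρ X W = ρ X' W')) := by
  have ne : ∀ X W, BddRV X → Measurable W → (Set.range W).Countable →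
      {x : ℝ | (fun w => ((P[|W ⁻¹' {w}]) {ω | X ω ≤ x}).toReal) ∈ D1 W}.Nonempty := by
    intro X W ⟨_, C, hC⟩ hW hc
    exact ⟨C, (aux_A P W _ (hD W hW hc) X C).1 fun ω => (abs_le.1 (hC ω)).2⟩
  have bb : ∀ X W, BddRV X → Measurable W → (Set.range W).Countable →
      BddBelow {x : ℝ | (fun w => ((P[|W ⁻¹' {w}]) {ω | X ω ≤ x}).toReal) ∈ D1 W} := by
    intro X W ⟨_, C, hC⟩ hW hc
    refine ⟨-C, fun x hx => ?_⟩
    by_contra! hlt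
    exact (aux_A P W _ (hD W hW hc) X x).2 (fun ω => hlt.trans_le (abs_le.1 (hC ω)).1) hx
  refine ⟨?_, ?_, ?_⟩
  · intro X Y W hX hY hW hc hle
    rw [hρ X W hX hW hc, hρ Y W hY hW hc]
    refine csInf_le_csInf (bb X W hX hW hc) (ne Y W hY hW hc) fun x hx => ?_
    refine aux_mono_s10 P W hW _ (hD W hW hc) _ _ ?_ hx
    filter_upwards [hle] with ω hω h2
    exact hω.trans h2
  · intro φ hφ hm X W hX hW hc
    have hb := aux_bdd_comp hX φ hφ hm
    rw [hρ _ W hb hW hc, hρ X W hX hW hc]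
    have hN := ne X W hX hW hc
    have hB := bb X W hX hW hc
    have hset : ∀ y, {ω | φ (X ω) ≤ φ y} = {ω | X ω ≤ y} := by
      intro y; ext ω; simp [hm.le_iff_le]
    apply le_antisymm
    · rw [hm.monotone.map_csInf_of_continuousAt hφ.continuousAt hN hB]
      refine csInf_le_csInf (bb _ W hb hW hc) (hN.image _) ?_
      rintro _ ⟨y, hy, rfl⟩
      simp only [mem_setOf_eq] at hy ⊢
      rw [hset]; exact hy
    · refine le_csInf (ne _ W hb hW hc) fun x hx => ?_
      by_cases hr : ∃ y, φ y = x
      · obtain ⟨y, rfl⟩ := hr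
        simp only [mem_setOf_eq] at hx
        rw [hset] at hx
        exact hm.monotone (csInf_le hB hx)
      · by_contra! hlt
        refine (aux_A P W _ (hD W hW hc) (fun ω => φ (X ω)) x).2 (fun ω => ?_) hx
        by_contra! hle
        exact hr (mem_range_of_exists_le_of_exists_ge hφ ⟨_, hle⟩ ⟨_, hlt.le⟩)
  · intro X X' W W' hX hX' hW hW' hc hc' hmap
    have hm : P.map W = P.map W' := by
      have := congrArg (fun ν => ν.map Prod.snd) hmap
      try simp only at this
      rwa [Measure.map_map measurable_snd (hX.1.prodMk hW),
        Measure.map_map measurable_snd (hX'.1.prodMk hW')] at this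
    rw [hρ X W hX hW hc, hρ X' W' hX' hW' hc', hL W W' hW hW' hc hc' hm]
    congr 2
    ext x
    have : ∀ w, ((P[|W ⁻¹' {w}]) {ω | X ω ≤ x}).toReal =
        ((P[|W' ⁻¹' {w}]) {ω | X' ω ≤ x}).toReal := by
      intro w
      rw [aux_cond P W hW, aux_cond P W' hW', measureReal_def, measureReal_def, measureReal_def,
        measureReal_def, aux_map_pre P W W' hW hW' hm]
      have hT : MeasurableSet (Iic x ×ˢ {w} : Set (ℝ × (Fin N → ℝ))) :=
        measurableSet_Iic.prod (measurableSet_singleton w)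
      have h2 := congrArg (fun ν => ν (Iic x ×ˢ {w})) hmap
      try simp only at h2
      rw [Measure.map_apply (hX.1.prodMk hW) hT, Measure.map_apply (hX'.1.prodMk hW') hT] at h2
      have e1 : ∀ (Z : Ω → ℝ) (V : Ω → (Fin N → ℝ)),
        (fun ω => (Z ω, V ω)) ⁻¹' (Iic x ×ˢ {w}) = {ω | Z ω ≤ x} ∩ V ⁻¹' {w} := by
        intro Z V; ext ω; simp
      rw [e1, e1] at h2
      rw [h2]
    simp only [this]

lemma aux_fwd {Ω : Type*} [MeasurableSpace Ω] (P : Measure Ω) [IsProbabilityMeasure P]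
    (hat : Atomless P)
    {N : ℕ} (ρ : (Ω → ℝ) → (Ω → (Fin N → ℝ)) → ℝ)
    (hM : ∀ X Y W, BddRV X → BddRV Y → Measurable W → (Set.range W).Countable →
        (∀ᵐ ω ∂P, X ω ≤ Y ω) → ρ X W ≤ ρ Y W)
    (hO : ∀ (φ : ℝ → ℝ), Continuous φ → StrictMono φ →
        ∀ X W, BddRV X → Measurable W → (Set.range W).Countable →
          ρ (fun ω => φ (X ω)) W = φ (ρ X W))
    (hLI : ∀ X X' W W', BddRV X → BddRV X' → Measurable W → Measurable W' →
        (Set.range W).Countable → (Set.range W').Countable →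
        (P.map fun ω => (X ω, W ω)) = (P.map fun ω => (X' ω, W' ω)) → ρ X W = ρ X' W') :
    ∃ D1 : (Ω → (Fin N → ℝ)) → Set ((Fin N → ℝ) → ℝ),
      (∀ W : Ω → (Fin N → ℝ), Measurable W → (Set.range W).Countable →
        IncreasingSetOn1 (S1 P W) (D1 W)) ∧
      (∀ W W' : Ω → (Fin N → ℝ), Measurable W → Measurable W' →
        (Set.range W).Countable → (Set.range W').Countable →
        P.map W = P.map W' → D1 W = D1 W') ∧
      (∀ X W, BddRV X → Measurable W → (Set.range W).Countable →
        ρ X W = sInf {x : ℝ |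
          (fun w => ((P[|W ⁻¹' {w}]) {ω | X ω ≤ x}).toReal) ∈ D1 W}) := by
  have bc : ∀ c : ℝ, BddRV (fun _ : Ω => c) := fun c => ⟨measurable_const, |c|, fun _ => le_rfl⟩
  have hconst : ∀ (c : ℝ) W, Measurable W → (range W).Countable → ρ (fun _ => c) W = c := by
    intro c W hW hc
    have := hO (fun x => 2 * x - c) (by fun_prop)
      (fun a b hab => by simp only; linarith) (fun _ => c) W (bc c) hW hc
    try simp only at this
    rw [show 2 * c - c = c by ring] at this
    linarith
  have hind : ∀ (A : Set Ω) W, MeasurableSet A → Measurable W → (range W).Countable →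
      ρ (A.indicator (fun _ => (1:ℝ))) W = 0 ∨ ρ (A.indicator (fun _ => (1:ℝ))) W = 1 := by
    intro A W hA hW hc
    have h0 : 0 ≤ ρ (A.indicator (fun _ => (1:ℝ))) W := by
      rw [← hconst 0 W hW hc]
      refine hM _ _ W (bc 0) (aux_bdd_ind A hA) hW hc (ae_of_all _ fun ω => ?_)
      by_cases h : ω ∈ A <;> simp [h]
    have := hO (fun x => x ^ 3) (by fun_prop) (Odd.strictMono_pow (by decide))
      (A.indicator (fun _ => (1:ℝ))) W (aux_bdd_ind A hA) hW hc
    have e : (fun ω => (A.indicator (fun _ => (1:ℝ)) ω) ^ 3) = A.indicator (fun _ => (1:ℝ)) := by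
      ext ω
      by_cases h : ω ∈ A <;> simp [h]
    try simp only at this
    rw [e] at this
    set r := ρ (A.indicator (fun _ => (1:ℝ))) W
    have h3 : r * ((r - 1) * (r + 1)) = 0 := by linear_combination -this
    rcases mul_eq_zero.1 h3 with h | h
    · exact Or.inl h
    · rcases mul_eq_zero.1 h with h | h
      · right; linarith
      · linarith
  let D1 : (Ω → (Fin N → ℝ)) → Set ((Fin N → ℝ) → ℝ) := fun W =>
    {f | (∀ w ∈ S1 P W, f w ∈ Icc (0:ℝ) 1) ∧ ∃ (B : Set Ω) (V : Ω → (Fin N → ℝ)),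
      MeasurableSet B ∧ Measurable V ∧ (range V).Countable ∧ P.map W = P.map V ∧
      (∀ w ∈ S1 P W, ((P[|V ⁻¹' {w}]) B).toReal ≤ f w) ∧
      ρ (Bᶜ.indicator (fun _ => (1:ℝ))) V = 0}
  refine ⟨D1, ?_, ?_, ?_⟩
  · intro W hW hc
    refine ⟨fun f hf => hf.1, ?_, ?_, ?_⟩
    · refine ⟨fun w _ => by simp, univ, W, MeasurableSet.univ, hW, hc, rfl,
        fun w _ => (aux_cond_mem P W hW w univ).2, ?_⟩
      simpa using hconst 0 W hW hc
    · rintro ⟨_, B, V, hB, hV, hVc, hmap, hle, h0⟩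
      have hS := aux_S1 P W V hW hV hmap
      have hB0 : P B = 0 := by
        refine aux_null P V hV hVc B hB fun w => ?_
        by_cases hw : w ∈ S1 P W
        · have h1 := hle w hw
          rw [hS] at hw
          rw [aux_cond P V hV] at h1
          have hp : 0 < P.real (V ⁻¹' {w}) := ENNReal.toReal_pos (ne_of_gt hw) (measure_ne_top _ _)
          have h2 : P.real (B ∩ V ⁻¹' {w}) ≤ 0 := by
            by_contra! h3
            have := mul_pos (inv_pos.2 hp) h3
            linarith
          exact (measureReal_eq_zero_iff).1 (h2.antisymm measureReal_nonneg)
        · rw [hS] at hw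
          simp only [S1, mem_setOf_eq, not_lt, nonpos_iff_eq_zero] at hw
          exact measure_mono_null inter_subset_right hw
      have : ρ (fun _ => 1) V ≤ ρ (Bᶜ.indicator (fun _ => (1:ℝ))) V := by
        refine hM _ _ V (bc 1) (aux_bdd_ind _ hB.compl) hV hVc ?_
        have : ∀ᵐ ω ∂P, ω ∉ B := measure_eq_zero_iff_ae_notMem.1 hB0
        filter_upwards [this] with ω hω
        simp [hω]
      rw [hconst 1 V hV hVc, h0] at this
      linarith
    · rintro g hg ⟨f, ⟨_, B, V, hB, hV, hVc, hmap, hle, h0⟩, hfg⟩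
      exact ⟨hg, B, V, hB, hV, hVc, hmap, fun w hw => (hle w hw).trans (hfg w hw), h0⟩
  · intro W W' hW hW' hc hc' hmap
    simp only [D1, aux_S1 P W W' hW hW' hmap, hmap]
  · intro X W hX hW hc
    obtain ⟨hXm, C, hC⟩ := id hX
    have hmeas : ∀ x, MeasurableSet {ω | X ω ≤ x} := fun x => hXm measurableSet_Iic
    have lower : ∀ x, (fun w => ((P[|W ⁻¹' {w}]) {ω | X ω ≤ x}).toReal) ∈ D1 W → ρ X W ≤ x := by
      rintro x ⟨_, B, V, hB, hV, hVc, hmap, hle, h0⟩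
      obtain ⟨B', hB'sub, hB', hBB⟩ := aux_transfer_s10 P hat W V hW hc {ω | X ω ≤ x} B (hmeas x) (by
        intro w
        by_cases hw : w ∈ S1 P W
        · have h1 := hle w hw
          simp only at h1
          have hp : 0 < P.real (W ⁻¹' {w}) := ENNReal.toReal_pos (ne_of_gt hw) (measure_ne_top _ _)
          have he : P.real (V ⁻¹' {w}) = P.real (W ⁻¹' {w}) := by
            rw [measureReal_def, measureReal_def, aux_map_pre P W V hW hV hmap]
          rw [aux_cond P V hV, aux_cond P W hW, he] at h1
          exact le_of_mul_le_mul_left h1 (inv_pos.2 hp)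
        · rw [aux_S1 P W V hW hV hmap] at hw
          simp only [S1, mem_setOf_eq, not_lt, nonpos_iff_eq_zero] at hw
          have : P (B ∩ V ⁻¹' {w}) = 0 := measure_mono_null inter_subset_right hw
          rw [measureReal_def, this]
          exact measureReal_nonneg)
      have hj := aux_joint P W V hW hV hc hVc hmap B' B hB' hB hBB
      have h1 := hLI _ _ W V (aux_bdd_ind _ hB'.compl) (aux_bdd_ind _ hB.compl) hW hV hc hVc hj
      rw [h0] at h1
      have hφc : Continuous (fun t : ℝ => x + (|C| + |x| + 1) * t) := by fun_prop
      have hφm : StrictMono (fun t : ℝ => x + (|C| + |x| + 1) * t) := by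
        intro a b hab
        have : 0 < |C| + |x| + 1 := by positivity
        simp only
        nlinarith
      have h2 := hO _ hφc hφm _ W (aux_bdd_ind _ hB'.compl) hW hc
      have h3 := hM _ _ W hX (aux_bdd_comp (aux_bdd_ind _ hB'.compl) _ hφc hφm) hW hc
        (ae_of_all _ fun ω => by
          by_cases h : ω ∈ B'
          · have := hB'sub h
            simp only [mem_setOf_eq] at this
            simpa [h] using this
          · have h4 := (abs_le.1 (hC ω)).2
            have h5 := le_abs_self C
            have h6 := neg_abs_le x
            simp [h]
            linarith)
      rw [h2, h1] at h3
      simpa using h3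
    have upper : ∀ x, ρ X W < x → (fun w => ((P[|W ⁻¹' {w}]) {ω | X ω ≤ x}).toReal) ∈ D1 W := by
      intro x hx
      refine ⟨fun w _ => aux_cond_mem P W hW w _, {ω | X ω ≤ x}, W, hmeas x, hW, hc, rfl,
        fun w _ => le_rfl, ?_⟩
      rcases hind _ W (hmeas x).compl hW hc with h | h
      · exact h
      · exfalso
        set K := |C| + |x| + 1 with hK
        have hxK : 0 < x + K := by have := neg_abs_le x; have := abs_nonneg C; linarith
        have hφc : Continuous (fun t : ℝ => -K + (x + K) * t) := by fun_prop
        have hφm : StrictMono (fun t : ℝ => -K + (x + K) * t) := by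
          intro a b hab
          simp only
          nlinarith
        have h2 := hO _ hφc hφm _ W (aux_bdd_ind _ (hmeas x).compl) hW hc
        have h3 := hM _ _ W (aux_bdd_comp (aux_bdd_ind _ (hmeas x).compl) _ hφc hφm) hX hW hc
          (ae_of_all _ fun ω => by
            by_cases h : X ω ≤ x
            · have h4 := (abs_le.1 (hC ω)).1
              have h5 := le_abs_self C
              have h6 := abs_nonneg x
              simp [h]
              linarith
            · simp [h]
              linarith)
        rw [h2, h] at h3
        linarith
    apply le_antisymm
    · exact le_csInf ⟨ρ X W + 1, upper _ (by linarith)⟩ fun x hx => lower x hx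
    · refine le_of_forall_gt fun x hx => ?_
      obtain ⟨y, hy1, hy2⟩ := exists_between hx
      exact (csInf_le ⟨ρ X W, fun z hz => lower z hz⟩ (upper y hy1)).trans_lt hy2

/-- **Corollary (quantile factor risk measures with discrete factors).** On the class
`𝒴_D` of discrete factors, `ρ` satisfies M, OR, LI iff there is a law-invariant family of
increasing sets `{D¹_W}` with `ρ(X, W) = inf {x : (F_{X|W=w}(x))_{w ∈ S¹_W} ∈ D¹_W}`. -/
theorem stmt10 {Ω : Type*} [MeasurableSpace Ω] (P : Measure Ω) [IsProbabilityMeasure P]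
    (hatomless : Atomless P) {N : ℕ} (hN : 1 ≤ N)
    (ρ : (Ω → ℝ) → (Ω → (Fin N → ℝ)) → ℝ) :
    ((∀ X Y W, BddRV X → BddRV Y → Measurable W → (Set.range W).Countable →
        (∀ᵐ ω ∂P, X ω ≤ Y ω) → ρ X W ≤ ρ Y W) ∧
     (∀ (φ : ℝ → ℝ), Continuous φ → StrictMono φ →
        ∀ X W, BddRV X → Measurable W → (Set.range W).Countable →
          ρ (fun ω => φ (X ω)) W = φ (ρ X W)) ∧
     (∀ X X' W W', BddRV X → BddRV X' → Measurable W → Measurable W' →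
        (Set.range W).Countable → (Set.range W').Countable →
        (P.map fun ω => (X ω, W ω)) = (P.map fun ω => (X' ω, W' ω)) → ρ X W = ρ X' W'))
    ↔
    ∃ D1 : (Ω → (Fin N → ℝ)) → Set ((Fin N → ℝ) → ℝ),
      (∀ W : Ω → (Fin N → ℝ), Measurable W → (Set.range W).Countable →
        IncreasingSetOn1 (S1 P W) (D1 W)) ∧
      (∀ W W' : Ω → (Fin N → ℝ), Measurable W → Measurable W' →
        (Set.range W).Countable → (Set.range W').Countable →
        P.map W = P.map W' → D1 W = D1 W') ∧
      (∀ X W, BddRV X → Measurable W → (Set.range W).Countable →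
        ρ X W = sInf {x : ℝ |
          (fun w => ((P[|W ⁻¹' {w}]) {ω | X ω ≤ x}).toReal) ∈ D1 W}) := by
  constructor
  · rintro ⟨h1, h2, h3⟩
    exact aux_fwd P hatomless ρ h1 h2 h3
  · rintro ⟨D1, h1, h2, h3⟩
    exact aux_back P ρ D1 h1 h2 h3
end
end
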